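/- Let f be a slice regular function on 𝔹 such that f(𝔹_I) ⊆ L_I for some I ∈ 𝕊. If f(x + yJ) = 0 for some J ∈ 𝕊 \ {±I}, then f(x + yK) = 0 for every K ∈ 𝕊. -/

import Mathlib

open MeasureTheory Filter Topology
open scoped ENNReal Classical

noncomputable section

/-! ### Basic quaternionic notions -/

instance : MeasurableSpace (Quaternion ℝ) := borel _
instance : BorelSpace (Quaternion ℝ) := ⟨rfl⟩

/-- The 2-sphere `𝕊` of quaternionic imaginary units. -/
def USphere : Set (Quaternion ℝ) := {q | q ^ 2 = -1}

/-- The open quaternionic unit ball `𝔹`. -/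
def QBall : Set (Quaternion ℝ) := {q | ‖q‖ < 1}

/-- The slice `L_I = ℝ + ℝI` through an imaginary unit `I`. -/
def sliceSet (I : Quaternion ℝ) : Set (Quaternion ℝ) :=
  {q | ∃ x y : ℝ, q = (x : Quaternion ℝ) + y • I}

/-- The point `e^{tI} = cos t + (sin t) I` of the boundary circle `∂𝔹_I`. -/
def ptOn (I : Quaternion ℝ) (t : ℝ) : Quaternion ℝ :=
  ((Real.cos t : ℝ) : Quaternion ℝ) + Real.sin t • I

/-- Slice regularity on the unit ball: on every slice the restriction of `f` has partial
derivatives satisfying the Cauchy–Riemann equation `∂f/∂x + I ∂f/∂y = 0`. -/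
def SliceRegular (f : Quaternion ℝ → Quaternion ℝ) : Prop :=
  ∀ I ∈ USphere, ∀ x y : ℝ, ((x : Quaternion ℝ) + y • I) ∈ QBall →
    ∃ fx fy : Quaternion ℝ,
      HasDerivAt (fun s : ℝ => f ((s : Quaternion ℝ) + y • I)) fx x ∧
      HasDerivAt (fun t : ℝ => f ((x : Quaternion ℝ) + t • I)) fy y ∧
      fx + I * fy = 0

/-! ### The Hardy space `H²(𝔹)` via power series coefficients.
A slice regular function on `𝔹` is identified with its coefficient sequence
`a : ℕ → ℍ`, the function being `q ↦ ∑ qⁿ aₙ`. -/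

/-- Membership in `H²(𝔹)`: square-summable coefficients. -/
def MemH2 (a : ℕ → Quaternion ℝ) : Prop := Summable (fun n => ‖a n‖ ^ 2)

/-- Evaluation of the power series `q ↦ ∑ qⁿ aₙ`. -/
def evalS (a : ℕ → Quaternion ℝ) (q : Quaternion ℝ) : Quaternion ℝ := ∑' n, q ^ n * a n

/-- The `*`-product (slice product) on coefficient sequences. -/
def sProd (a b : ℕ → Quaternion ℝ) : ℕ → Quaternion ℝ :=
  fun n => ∑ k ∈ Finset.range (n + 1), a k * b (n - k)

/-- The regular conjugate `fᶜ`. -/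
def conjS (a : ℕ → Quaternion ℝ) : ℕ → Quaternion ℝ := fun n => star (a n)

/-- The symmetrization `fˢ = f * fᶜ`. -/
def symmS (a : ℕ → Quaternion ℝ) : ℕ → Quaternion ℝ := sProd a (conjS a)

/-- The squared `H²` norm `∑ ‖aₙ‖²`. -/
def h2normSq (a : ℕ → Quaternion ℝ) : ℝ := ∑' n, ‖a n‖ ^ 2

/-- The `H²` norm. -/
def h2norm (a : ℕ → Quaternion ℝ) : ℝ := Real.sqrt (h2normSq a)

/-- The (right) quaternionic inner product `⟨f,g⟩ = ∑ conj(bₙ) aₙ` of `H²(𝔹)`. -/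
def h2inner (a b : ℕ → Quaternion ℝ) : Quaternion ℝ := ∑' n, star (b n) * a n

/-- Squared `H²`-distance of two coefficient sequences (valued in `ℝ≥0∞`). -/
def h2distSq (a b : ℕ → Quaternion ℝ) : ℝ≥0∞ := ∑' n, (‖a n - b n‖₊ : ℝ≥0∞) ^ 2

/-- The boundary value function of `f ∈ H²(𝔹)`, given by the radial limit where it exists. -/
def bdval (a : ℕ → Quaternion ℝ) (q : Quaternion ℝ) : Quaternion ℝ :=
  if h : ∃ L, Tendsto (fun r : ℝ => evalS a ((r : Quaternion ℝ) * q)) (𝓝[<] (1 : ℝ)) (𝓝 L)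
  then h.choose else 0

/-! ### The measure `Σ` on `∂𝔹` with `dΣ(e^{tI}) = dσ(I) dt`. -/

/-- The normalized area measure `σ` on the sphere `𝕊` of imaginary units
(2-dimensional Hausdorff measure, normalized so that `σ(𝕊) = 1`). -/
def sphMeasure : Measure (Quaternion ℝ) := (μH[2] USphere)⁻¹ • (μH[2]).restrict USphere

/-- The measure `Σ` on `∂𝔹`, `dΣ(e^{tI}) = dσ(I) dt`, normalized so `Σ(∂𝔹) = 1`. -/
def SigmaBd : Measure (Quaternion ℝ) :=
  (ENNReal.ofReal (2 * Real.pi))⁻¹ •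
    Measure.map (fun p : ℝ × Quaternion ℝ => ptOn p.2 p.1)
      ((volume.restrict (Set.Ico 0 (2 * Real.pi))).prod sphMeasure)

/-! ### Inner, outer, cyclic -/

/-- `f ∈ H^∞(𝔹)`: a bounded function of `H²(𝔹)`. -/
def MemHinf (a : ℕ → Quaternion ℝ) : Prop :=
  MemH2 a ∧ ∃ C : ℝ, ∀ q ∈ QBall, ‖evalS a q‖ ≤ C

/-- The `H^∞` norm: the sup of `‖f‖` on the ball. -/
def hInfNorm (a : ℕ → Quaternion ℝ) : ℝ := sSup ((fun q => ‖evalS a q‖) '' QBall)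

/-- `f` is inner: `f ∈ H^∞(𝔹)`, `‖f‖ ≤ 1` on `𝔹` and `‖f‖ = 1` `Σ`-a.e. on `∂𝔹`. -/
def IsInnerQ (a : ℕ → Quaternion ℝ) : Prop :=
  MemH2 a ∧ (∀ q ∈ QBall, ‖evalS a q‖ ≤ 1) ∧ (∀ᵐ q ∂SigmaBd, ‖bdval a q‖ = 1)

/-- `g` is outer: whenever `f ∈ H²(𝔹)` has the same boundary modulus `Σ`-a.e.,
then `‖g‖ ≥ ‖f‖` throughout `𝔹`. -/
def IsOuterQ (g : ℕ → Quaternion ℝ) : Prop :=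
  MemH2 g ∧ ∀ f, MemH2 f → (∀ᵐ q ∂SigmaBd, ‖bdval g q‖ = ‖bdval f q‖) →
    ∀ q ∈ QBall, ‖evalS f q‖ ≤ ‖evalS g q‖

/-- Quaternionic polynomials (finitely supported coefficient sequences). -/
def IsPolyQ (p : ℕ → Quaternion ℝ) : Prop := ∃ N, ∀ n > N, p n = 0

/-- Quaternionic polynomials of degree at most `n` (the space `𝒫_n`). -/
def IsPolyDeg (p : ℕ → Quaternion ℝ) (n : ℕ) : Prop := ∀ m > n, p m = 0

/-- The coefficient sequence of the monomial `qᵏ`. -/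
def qpow (k : ℕ) : ℕ → Quaternion ℝ := fun n => if n = k then 1 else 0

/-- The coefficient sequence of a constant function. -/
def constS (c : Quaternion ℝ) : ℕ → Quaternion ℝ := fun n => if n = 0 then c else 0

/-- The coefficient sequence of the constant function `1`. -/
def oneS : ℕ → Quaternion ℝ := constS 1

/-- The invariant subspace `[g]`: the `H²`-closure of `{g * p : p polynomial}`,
i.e. of the right span of `{qⁿ * g : n ≥ 0}`. -/
def InvSub (g : ℕ → Quaternion ℝ) : Set (ℕ → Quaternion ℝ) :=
  {h | MemH2 h ∧ ∀ ε : ℝ≥0∞, 0 < ε → ∃ p, IsPolyQ p ∧ h2distSq (sProd g p) h < ε}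

/-- `g` is cyclic: `[g] = H²(𝔹)`. -/
def IsCyclicQ (g : ℕ → Quaternion ℝ) : Prop :=
  MemH2 g ∧ ∀ h, MemH2 h → h ∈ InvSub g

/-! ### Bilateral (slice `L²`) series, used for boundary products -/

/-- Bilateral coefficients of `f̃(q) = f(q̄)` on `∂𝔹`: `Σ_{n ≤ 0} qⁿ a_{-n}`. -/
def tildeZ (a : ℕ → Quaternion ℝ) : ℤ → Quaternion ℝ :=
  fun k => if k ≤ 0 then a (-k).toNat else 0

/-- Bilateral coefficients of `fᶜ` on `∂𝔹`. -/
def conjZ (a : ℕ → Quaternion ℝ) : ℤ → Quaternion ℝ :=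
  fun k => if 0 ≤ k then star (a k.toNat) else 0

/-- The `*`-product of two slice `L²` functions on the boundary, on coefficients. -/
def convZ (c b : ℤ → Quaternion ℝ) : ℤ → Quaternion ℝ := fun n => ∑' k : ℤ, c k * b (n - k)

/-- Evaluation of a bilateral series `q ↦ ∑_{n ∈ ℤ} qⁿ dₙ`. -/
def evalZ (d : ℤ → Quaternion ℝ) (q : Quaternion ℝ) : Quaternion ℝ := ∑' n : ℤ, q ^ n * d n

/-- The slice inner product `⟨qᵏ * f, f⟩_I = (1/2π)∫₀^{2π} conj(f(e^{θI})) (e^{θI})ᵏ f(e^{θI}) dθ`,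
computed with boundary values; note `(qᵏ * f)(q) = qᵏ f(q)` pointwise. -/
def sliceInnerPow (a : ℕ → Quaternion ℝ) (I : Quaternion ℝ) (k : ℕ) : Quaternion ℝ :=
  (2 * Real.pi)⁻¹ •
    ∫ t in Set.Ico 0 (2 * Real.pi), star (bdval a (ptOn I t)) * ((ptOn I t) ^ k * bdval a (ptOn I t))

/-! ### Complex Hardy space `H²(𝔻)` notions (for slice restrictions) -/

/-- Membership in the complex Hardy space `H²(𝔻)` via coefficients. -/
def CMemH2 (c : ℕ → ℂ) : Prop := Summable (fun n => ‖c n‖ ^ 2)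

/-- Evaluation of a complex power series. -/
def cEval (c : ℕ → ℂ) (z : ℂ) : ℂ := ∑' n, z ^ n * c n

/-- Cauchy product of complex coefficient sequences. -/
def cConv (c d : ℕ → ℂ) : ℕ → ℂ := fun n => ∑ k ∈ Finset.range (n + 1), c k * d (n - k)

/-- Squared `H²(𝔻)` distance. -/
def cDistSq (c d : ℕ → ℂ) : ℝ≥0∞ := ∑' n, (‖c n - d n‖₊ : ℝ≥0∞) ^ 2

/-- Radial boundary values of a complex `H²` function. -/
def cBdval (c : ℕ → ℂ) (z : ℂ) : ℂ :=
  if h : ∃ L, Tendsto (fun r : ℝ => cEval c ((r : ℂ) * z)) (𝓝[<] (1 : ℝ)) (𝓝 L)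
  then h.choose else 0

/-- Lebesgue measure on the unit circle `∂𝔻` (parametrized by `θ ∈ [0, 2π)`). -/
def circleM : Measure ℂ :=
  Measure.map (fun t : ℝ => Complex.exp (t * Complex.I)) (volume.restrict (Set.Ico 0 (2 * Real.pi)))

/-- Cyclicity in `H²(𝔻)`: polynomial multiples of `c` are dense. -/
def CIsCyclic (c : ℕ → ℂ) : Prop :=
  CMemH2 c ∧ ∀ h, CMemH2 h → ∀ ε : ℝ≥0∞, 0 < ε →
    ∃ p : ℕ → ℂ, (∃ N, ∀ n > N, p n = 0) ∧ cDistSq (cConv c p) h < ε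

/-- Outerness in `H²(𝔻)` (in the sense matching Definition 2.10 of the paper). -/
def CIsOuter (c : ℕ → ℂ) : Prop :=
  CMemH2 c ∧ ∀ h, CMemH2 h →
    (∀ᵐ z ∂circleM, ‖cBdval c z‖ = ‖cBdval h z‖) →
    ∀ z ∈ Metric.ball (0 : ℂ) 1, ‖cEval h z‖ ≤ ‖cEval c z‖

/-- Complex coordinates of a point of the slice `L_I`: if `p = x + yI` then
`sliceToC I p = x + iy`. -/
def sliceToC (I : Quaternion ℝ) (p : Quaternion ℝ) : ℂ := ⟨p.re, -(p * I).re⟩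

/-- The quaternion `i`. -/
def qI : Quaternion ℝ := ⟨0, 1, 0, 0⟩

/-- The embedding of `ℂ = L_i` into the quaternions. -/
def cToQ (z : ℂ) : Quaternion ℝ := (z.re : Quaternion ℝ) + z.im • qI

/-- The imaginary unit `I_ω` identified by `ω` (any imaginary unit if `ω` is real). -/
def Iu (ω : Quaternion ℝ) : Quaternion ℝ := if ω.im = 0 then qI else ‖ω.im‖⁻¹ • ω.im

/-! ### Optimal approximants -/

/-- `p` is an optimal approximant of degree `n` of `f^{-*}`: `p ∈ 𝒫_n` minimizes
`‖f * p - 1‖_{H²}` among all `p ∈ 𝒫_n`. -/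
def IsOptApprox (a : ℕ → Quaternion ℝ) (n : ℕ) (p : ℕ → Quaternion ℝ) : Prop :=
  IsPolyDeg p n ∧ ∀ r, IsPolyDeg r n → h2distSq (sProd a p) oneS ≤ h2distSq (sProd a r) oneS

end

namespace LM
open Set
open scoped NNReal

lemma oneD_real (f f' : ℝ → ℝ) (a b : ℝ) (hab : a ≤ b) (F : Set ℝ) (hFc : IsClosed F)
    (hF : F ⊆ Icc a b) (hne : F.Nonempty) (K : ℝ≥0)
    (hd : ∀ t ∈ F, HasDerivAt f (f' t) t)
    (hL : ∀ t ∈ F, ∀ s ∈ Icc a b, |f s - f t| ≤ K * |s - t|) :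
    |f b - f a - ∫ t in F, f' t| ≤ K * volume.real (Icc a b \ F) := by
  obtain ⟨t0, ht0⟩ := hne
  have hab' : |f b - f a| ≤ K * |b - a| := by
    have h1 := hL t0 ht0 b ⟨hab, le_rfl⟩
    have h2 := hL t0 ht0 a ⟨le_rfl, hab⟩
    have h3 := hF ht0
    rw [abs_of_nonneg (by linarith [h3.2] : 0 ≤ b - t0)] at h1
    rw [abs_of_nonpos (by linarith [h3.1] : a - t0 ≤ 0)] at h2
    rw [abs_of_nonneg (by linarith : 0 ≤ b - a)]
    have : |f b - f a| ≤ |f b - f t0| + |f a - f t0| := by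
      have := abs_sub (f b - f t0) (f a - f t0)
      simpa using this
    nlinarith
  have hLip : LipschitzOnWith K f (F ∪ {a, b}) := by
    apply LipschitzOnWith.of_dist_le_mul
    intro s hs t ht
    rw [Real.dist_eq, Real.dist_eq]
    have hIcc : ∀ u ∈ F ∪ {a, b}, u ∈ Icc a b := by
      rintro u (hu | hu | hu)
      · exact hF hu
      · rw [hu]; exact ⟨le_rfl, hab⟩
      · rw [mem_singleton_iff] at hu; rw [hu]; exact ⟨hab, le_rfl⟩
    rcases ht with ht' | ht'
    · exact hL t ht' s (hIcc s hs)
    · rcases hs with hs' | hs'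
      · rw [abs_sub_comm, abs_sub_comm s t]
        exact hL s hs' t (hIcc t (Or.inr ht'))
      · rcases hs' with rfl | hs' <;> rcases ht' with rfl | ht'
        · simp
        · rw [mem_singleton_iff] at ht'; subst ht'
          rw [abs_sub_comm, abs_sub_comm s t]; exact hab'
        · rw [mem_singleton_iff] at hs'; subst hs'; exact hab'
        · rw [mem_singleton_iff] at hs' ht'; subst hs'; subst ht'; simp
  obtain ⟨G, hG, hGf⟩ := hLip.extend_real
  have hAC : AbsolutelyContinuousOnInterval G a b :=
    (hG.lipschitzOnWith).absolutelyContinuousOnInterval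
  have hIntEq := hAC.integral_deriv_eq_sub
  have hii := hAC.intervalIntegrable_deriv
  rw [← hGf (by simp), ← hGf (by simp)] at hIntEq
  rw [intervalIntegral.integral_of_le hab, ← integral_Icc_eq_integral_Ioc] at hIntEq
  rw [intervalIntegrable_iff_integrableOn_Icc_of_le hab] at hii
  have hsplit : ∫ t in Icc a b, deriv G t = (∫ t in F, deriv G t) + ∫ t in Icc a b \ F, deriv G t := by
    rw [← setIntegral_union disjoint_sdiff_right (measurableSet_Icc.diff hFc.measurableSet)
      (hii.mono_set hF) (hii.mono_set sdiff_subset), union_sdiff_cancel hF]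
  have hae : ∫ t in F, deriv G t = ∫ t in F, f' t := by
    apply setIntegral_congr_ae hFc.measurableSet
    have hc : {x | x ∈ F ∧ 𝓝[F ∩ Ioi x] x = ⊥}.Countable := countable_setOfPred_isolated_right_within
    filter_upwards [hG.ae_differentiableAt, hc.ae_notMem volume] with t h1 h2 h3
    have hU : UniqueDiffWithinAt ℝ F t := by
      rw [uniqueDiffWithinAt_iff_accPt, accPt_principal_iff_nhdsWithin]
      have h4 : (𝓝[F ∩ Ioi t] t).NeBot := neBot_iff.2 fun h => h2 ⟨h3, h⟩
      refine h4.mono (nhdsWithin_mono _ ?_)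
      rintro s ⟨hs, hs'⟩
      exact ⟨hs, ne_of_gt hs'⟩
    have e1 := (h1.hasDerivAt.hasDerivWithinAt (s := F))
    have e2 := ((hd t h3).hasDerivWithinAt (s := F))
    have e3 : HasDerivWithinAt G (f' t) F t :=
      e2.congr (fun s hs => (hGf (Or.inl hs)).symm) (hGf (Or.inl h3)).symm
    exact hU.eq_deriv _ e1 e3
  have hbd : |∫ t in Icc a b \ F, deriv G t| ≤ K * volume.real (Icc a b \ F) := by
    rw [← Real.norm_eq_abs]
    apply norm_setIntegral_le_of_norm_le_const
    · exact lt_of_le_of_lt (measure_mono sdiff_subset) measure_Icc_lt_top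
    · intro x _
      exact norm_deriv_le_of_lipschitz hG
  have : f b - f a - ∫ t in F, f' t = ∫ t in Icc a b \ F, deriv G t := by
    rw [← hIntEq, hsplit, hae]; ring
  rw [this]; exact hbd

lemma oneD (f f' : ℝ → ℂ) (a b : ℝ) (hab : a ≤ b) (F : Set ℝ) (hFc : IsClosed F)
    (hF : F ⊆ Icc a b) (hne : F.Nonempty) (K : ℝ) (hK : 0 ≤ K)
    (hd : ∀ t ∈ F, HasDerivAt f (f' t) t) (hi : IntegrableOn f' F)
    (hL : ∀ t ∈ F, ∀ s ∈ Icc a b, ‖f s - f t‖ ≤ K * |s - t|) :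
    ‖f b - f a - ∫ t in F, f' t‖ ≤ 2 * K * volume.real (Icc a b \ F) := by
  lift K to ℝ≥0 using hK
  have h1 := oneD_real (fun t => (f t).re) (fun t => (f' t).re) a b hab F hFc hF hne K
    (fun t ht => Complex.reCLM.hasFDerivAt.comp_hasDerivAt t (hd t ht))
    (fun t ht s hs => by
      have := (Complex.abs_re_le_norm (f s - f t)).trans (hL t ht s hs)
      simpa using this)
  have h2 := oneD_real (fun t => (f t).im) (fun t => (f' t).im) a b hab F hFc hF hne K
    (fun t ht => Complex.imCLM.hasFDerivAt.comp_hasDerivAt t (hd t ht))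
    (fun t ht s hs => by
      have := (Complex.abs_im_le_norm (f s - f t)).trans (hL t ht s hs)
      simpa using this)
  have e1 : ∫ t in F, (f' t).re = (∫ t in F, f' t).re := Complex.reCLM.integral_comp_comm hi
  have e2 : ∫ t in F, (f' t).im = (∫ t in F, f' t).im := Complex.imCLM.integral_comp_comm hi
  rw [e1] at h1
  rw [e2] at h2
  have := Complex.norm_le_abs_re_add_abs_im (f b - f a - ∫ t in F, f' t)
  simp only [Complex.sub_re, Complex.sub_im] at this
  linarith

end LM


namespace LM
open Set
open scoped NNReal

/-- Globally separately continuous and bounded functions of two real variables. -/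
structure SC (g : ℝ → ℝ → ℂ) (M : ℝ) : Prop where
  hx : ∀ y, Continuous (fun x => g x y)
  hy : ∀ x, Continuous (fun y => g x y)
  hb : ∀ x y, ‖g x y‖ ≤ M

lemma SC.swap {g : ℝ → ℝ → ℂ} {M : ℝ} (h : SC g M) : SC (fun x y => g y x) M :=
  ⟨h.hy, h.hx, fun x y => h.hb y x⟩

lemma SC.meas {g : ℝ → ℝ → ℂ} {M : ℝ} (h : SC g M) : Measurable (fun p : ℝ × ℝ => g p.1 p.2) := by
  have := measurable_uncurry_of_continuous_of_measurable (u := g)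
    (fun x => h.hx x) (fun x => (h.hy x).measurable)
  exact this

lemma half {g : ℝ → ℝ → ℂ} {M : ℝ} (hg : SC g M) (F : Set (ℝ × ℝ)) (hFc : IsClosed F)
    (D : ℝ × ℝ → ℂ) (hDm : Measurable D) (K : ℝ) (hK : 0 ≤ K) (hDb : ∀ p, ‖D p‖ ≤ K)
    (hD0 : ∀ p, p ∉ F → D p = 0)
    (a b c d a' b' c' d' ρ : ℝ) (ha : a ≤ a') (hab : a' ≤ b') (hb : b' ≤ b)
    (hc : c ≤ c') (hcd : c' ≤ d') (hd : d' ≤ d) (hρ : 0 ≤ ρ) (hasp : b - a ≤ ρ * (d - c))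
    (hE : ∀ z ∈ F, z.1 ∈ Icc a b → z.2 ∈ Icc c d → z.1 ∈ Icc a' b' ∧ z.2 ∈ Icc c' d')
    (xt xb : ℝ) (hxt : xt ∈ Icc a b) (hxb : xb ∈ Icc a b) (hxt' : (xt, d') ∈ F)
    (hxb' : (xb, c') ∈ F)
    (hcx : ∀ z ∈ F, z.1 ∈ Icc a b → z.2 ∈ Icc c d → ∀ s ∈ Icc a b,
      ‖g s z.2 - g z.1 z.2‖ ≤ K * |s - z.1|)
    (hcy : ∀ z ∈ F, z.1 ∈ Icc a b → z.2 ∈ Icc c d → ∀ t ∈ Icc c d,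
      ‖g z.1 t - g z.1 z.2‖ ≤ K * |t - z.2|)
    (hder : ∀ z ∈ F, z.1 ∈ Icc a b → z.2 ∈ Icc c d → HasDerivAt (fun t => g z.1 t) (D z) z.2) :
    ‖(∫ x in a'..b', (g x d' - g x c')) - ∫ p in Icc a b ×ˢ Icc c d, D p‖
      ≤ K * (3 + 3 * ρ) * ∫ p in Icc a b ×ˢ Icc c d, Fᶜ.indicator (fun _ => (1:ℝ)) p := by
  have hd'm : d' ∈ Icc c d := ⟨hc.trans hcd, hd⟩
  have hc'm : c' ∈ Icc c d := ⟨hc, hcd.trans hd⟩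
  have hcd0 : c ≤ d := hc'm.1.trans hc'm.2
  have hab0 : a ≤ b := hxt.1.trans hxt.2
  have hFm := hFc.measurableSet
  -- integrability of D and N
  have hDi : IntegrableOn D (Icc a b ×ˢ Icc c d) := by
    apply Measure.integrableOn_of_bounded (M := K)
    · exact ((isCompact_Icc.prod isCompact_Icc).measure_lt_top).ne
    · exact hDm.aestronglyMeasurable
    · exact Eventually.of_forall hDb
  set N : ℝ × ℝ → ℝ := Fᶜ.indicator (fun _ => (1:ℝ)) with hN
  have hNm : Measurable N := measurable_const.indicator hFm.compl
  have hNb : ∀ p, ‖N p‖ ≤ 1 := by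
    intro p; rw [hN, indicator]; split_ifs <;> simp
  have hN0 : ∀ p, 0 ≤ N p := by
    intro p; rw [hN, indicator]; split_ifs <;> simp
  have hNi : IntegrableOn N (Icc a b ×ˢ Icc c d) := by
    apply Measure.integrableOn_of_bounded (M := 1)
    · exact ((isCompact_Icc.prod isCompact_Icc).measure_lt_top).ne
    · exact hNm.aestronglyMeasurable
    · exact Eventually.of_forall hNb
  have hline : ∀ x ∈ Icc a b, ‖g x d' - g x c' - ∫ y in Icc c d, D (x, y)‖
      ≤ K * (3 + 3 * ρ) * ∫ y in Icc c d, N (x, y) := by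
    intro x hx
    set Fx : Set ℝ := {y | y ∈ Icc c d ∧ (x, y) ∈ F} with hFx
    have hFxc : IsClosed Fx := isClosed_Icc.inter (hFc.preimage (by fun_prop : Continuous fun y : ℝ => (x, y)))
    have hNv : ∫ y in Icc c d, N (x, y) = volume.real (Icc c d \ Fx) := by
      have : ∀ y ∈ Icc c d, N (x, y) = (Fxᶜ).indicator (fun _ => (1:ℝ)) y := by
        intro y hy
        simp only [hN, indicator, hFx, mem_compl_iff, mem_ofPred_eq, hy, true_and]
      rw [setIntegral_congr_fun measurableSet_Icc this, setIntegral_indicator hFxc.measurableSet.compl,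
        setIntegral_const, sdiff_eq]
      simp
    have hDv : ∫ y in Icc c d, D (x, y) = ∫ y in Fx, D (x, y) := by
      apply setIntegral_eq_of_subset_of_forall_sdiff_eq_zero measurableSet_Icc (fun y hy => hy.1)
      intro y hy
      exact hD0 _ (fun h => hy.2 ⟨hy.1, h⟩)
    by_cases hne : Fx.Nonempty
    · have hFx' : Fx ⊆ Icc c' d' := fun y hy => (hE (x, y) hy.2 hx hy.1).2
      have key := oneD (fun y => g x y) (fun y => D (x, y)) c' d' hcd Fx hFxc hFx' hne K hK
        (fun t ht => hder (x, t) ht.2 hx ht.1)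
        (by
          apply Measure.integrableOn_of_bounded (M := K)
          · exact (lt_of_le_of_lt (measure_mono hFx') measure_Icc_lt_top).ne
          · exact (hDm.comp (by fun_prop : Measurable fun y : ℝ => (x, y))).aestronglyMeasurable
          · exact Eventually.of_forall fun _ => hDb _)
        (fun t ht s hs => hcy (x, t) ht.2 hx ht.1 s ⟨hc.trans hs.1, hs.2.trans hd⟩)
      rw [hDv, hNv]
      refine key.trans ?_
      have h1 : volume.real (Icc c' d' \ Fx) ≤ volume.real (Icc c d \ Fx) := by
        apply measureReal_mono
        · exact sdiff_subset_sdiff_left (Icc_subset_Icc hc hd)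
        · exact (lt_of_le_of_lt (measure_mono sdiff_subset) measure_Icc_lt_top).ne
      have h0 : 0 ≤ volume.real (Icc c' d' \ Fx) := measureReal_nonneg
      have : 2 * K ≤ K * (3 + 3 * ρ) := by nlinarith [mul_nonneg hK hρ]
      gcongr
    · rw [not_nonempty_iff_eq_empty] at hne
      rw [hDv, hNv, hne]
      simp only [setIntegral_empty, sub_zero, sdiff_empty, Real.volume_real_Icc_of_le hcd0]
      have e1 := hcx _ hxt' hxt hd'm x hx
      have e2 := hcy _ hxt' hxt hd'm c' hc'm
      have e3 := hcx _ hxb' hxb hc'm xt hxt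
      have e4 := hcx _ hxb' hxb hc'm x hx
      simp only at e1 e2 e3 e4
      have f1 : |x - xt| ≤ b - a := by rw [abs_le]; constructor <;> linarith [hx.1, hx.2, hxt.1, hxt.2]
      have f2 : |c' - d'| ≤ d - c := by
        rw [abs_le]; constructor <;> linarith
      have f3 : |xt - xb| ≤ b - a := by rw [abs_le]; constructor <;> linarith [hxb.1, hxb.2, hxt.1, hxt.2]
      have f4 : |x - xb| ≤ b - a := by rw [abs_le]; constructor <;> linarith [hx.1, hx.2, hxb.1, hxb.2]
      have e1' := e1.trans (mul_le_mul_of_nonneg_left f1 hK)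
      have e2' := e2.trans (mul_le_mul_of_nonneg_left f2 hK)
      have e3' := e3.trans (mul_le_mul_of_nonneg_left f3 hK)
      have e4' := e4.trans (mul_le_mul_of_nonneg_left f4 hK)
      have : g x d' - g x c' = (g x d' - g xt d') - (g xt c' - g xt d') + (g xt c' - g xb c')
          - (g x c' - g xb c') := by ring
      rw [this]
      have t1 := norm_sub_le ((g x d' - g xt d') - (g xt c' - g xt d') + (g xt c' - g xb c')) (g x c' - g xb c')
      have t2 := norm_add_le ((g x d' - g xt d') - (g xt c' - g xt d')) (g xt c' - g xb c')
      have t3 := norm_sub_le (g x d' - g xt d') (g xt c' - g xt d')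
      have f5 : K * (b - a) ≤ K * (ρ * (d - c)) := mul_le_mul_of_nonneg_left hasp hK
      nlinarith [mul_nonneg hK (sub_nonneg.2 hcd0)]
  have hI : Icc a' b' ⊆ Icc a b := Icc_subset_Icc ha hb
  have hDint : ∫ p in Icc a b ×ˢ Icc c d, D p = ∫ x in Icc a' b', ∫ y in Icc c d, D (x, y) := by
    rw [Measure.volume_eq_prod] at hDi ⊢
    rw [setIntegral_prod _ hDi]
    apply setIntegral_eq_of_subset_of_forall_sdiff_eq_zero measurableSet_Icc hI
    intro x hx
    apply setIntegral_eq_zero_of_forall_eq_zero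
    intro y hy
    exact hD0 _ (fun h => hx.2 (hE (x, y) h hx.1 hy).1)
  have hDx : IntegrableOn (fun x => ∫ y in Icc c d, D (x, y)) (Icc a' b') := by
    rw [Measure.volume_eq_prod, IntegrableOn, ← Measure.prod_restrict] at hDi
    exact (hDi.integral_prod_left).mono_measure (Measure.restrict_mono hI le_rfl)
  have hNx : IntegrableOn (fun x => ∫ y in Icc c d, N (x, y)) (Icc a b) := by
    rw [Measure.volume_eq_prod, IntegrableOn, ← Measure.prod_restrict] at hNi
    exact hNi.integral_prod_left
  have hgx : IntegrableOn (fun x => g x d' - g x c') (Icc a' b') :=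
    ((hg.hx d').sub (hg.hx c')).integrableOn_Icc
  rw [intervalIntegral.integral_of_le hab, ← integral_Icc_eq_integral_Ioc, hDint,
    ← integral_sub hgx hDx]
  calc _ ≤ ∫ x in Icc a' b', K * (3 + 3 * ρ) * ∫ y in Icc c d, N (x, y) := by
        apply norm_integral_le_of_norm_le ((hNx.mono_set hI).const_mul _)
        filter_upwards [ae_restrict_mem measurableSet_Icc] with x hx
        exact hline x (hI hx)
    _ ≤ ∫ x in Icc a b, K * (3 + 3 * ρ) * ∫ y in Icc c d, N (x, y) := by
        apply setIntegral_mono_set (hNx.const_mul _)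
        · apply Eventually.of_forall
          intro x
          have : 0 ≤ ∫ y in Icc c d, N (x, y) := integral_nonneg fun y => hN0 _
          simp only [Pi.zero_apply]
          positivity
        · exact hI.eventuallyLE
    _ = _ := by
        rw [integral_const_mul]
        congr 1
        rw [Measure.volume_eq_prod] at hNi ⊢
        rw [setIntegral_prod _ hNi]

end LM


namespace LM
open Set
open scoped NNReal

/-- Boundary integral over a rectangle. -/
noncomputable def bdI (g : ℝ → ℝ → ℂ) (a b c d : ℝ) : ℂ :=
  (∫ x in a..b, g x c) - (∫ x in a..b, g x d) + Complex.I * (∫ y in c..d, g b y)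
    - Complex.I * (∫ y in c..d, g a y)

lemma SC.iix {g : ℝ → ℝ → ℂ} {M : ℝ} (h : SC g M) (y a b : ℝ) :
    IntervalIntegrable (fun x => g x y) volume a b := (h.hx y).intervalIntegrable a b

lemma SC.iiy {g : ℝ → ℝ → ℂ} {M : ℝ} (h : SC g M) (x a b : ℝ) :
    IntervalIntegrable (fun y => g x y) volume a b := (h.hy x).intervalIntegrable a b

lemma bdI_addx {g : ℝ → ℝ → ℂ} {M : ℝ} (h : SC g M) (a m b c d : ℝ) :
    bdI g a b c d = bdI g a m c d + bdI g m b c d := by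
  unfold bdI
  rw [← intervalIntegral.integral_add_adjacent_intervals (h.iix c a m) (h.iix c m b),
    ← intervalIntegral.integral_add_adjacent_intervals (h.iix d a m) (h.iix d m b)]
  ring

lemma bdI_addy {g : ℝ → ℝ → ℂ} {M : ℝ} (h : SC g M) (a b c m d : ℝ) :
    bdI g a b c d = bdI g a b c m + bdI g a b m d := by
  unfold bdI
  rw [← intervalIntegral.integral_add_adjacent_intervals (h.iiy a c m) (h.iiy a m d),
    ← intervalIntegral.integral_add_adjacent_intervals (h.iiy b c m) (h.iiy b m d)]
  ring

lemma bdI_selfx (g : ℝ → ℝ → ℂ) (a c d : ℝ) : bdI g a a c d = 0 := by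
  simp [bdI]

lemma bdI_selfy (g : ℝ → ℝ → ℂ) (a b c : ℝ) : bdI g a b c c = 0 := by
  simp [bdI]

lemma SC.contx {g : ℝ → ℝ → ℂ} {M : ℝ} (h : SC g M) (a b : ℝ) :
    Continuous (fun y => ∫ x in a..b, g x y) := by
  apply intervalIntegral.continuous_of_dominated_interval (bound := fun _ => M)
  · exact fun y => (h.hx y).aestronglyMeasurable
  · exact fun y => Eventually.of_forall fun x _ => h.hb x y
  · exact intervalIntegrable_const
  · exact Eventually.of_forall fun x _ => h.hy x

lemma SC.conty {g : ℝ → ℝ → ℂ} {M : ℝ} (h : SC g M) (c d : ℝ) :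
    Continuous (fun x => ∫ y in c..d, g x y) := h.swap.contx c d

lemma cont_upper {f : ℝ → ℂ} (hf : Continuous f) (a : ℝ) : Continuous fun b => ∫ x in a..b, f x :=
  intervalIntegral.continuous_primitive (fun a b => hf.intervalIntegrable a b) a

lemma cont_lower {f : ℝ → ℂ} (hf : Continuous f) (b : ℝ) : Continuous fun a => ∫ x in a..b, f x := by
  have : (fun a => ∫ x in a..b, f x) = fun a => - ∫ x in b..a, f x := by
    funext a; rw [intervalIntegral.integral_symm]
  rw [this]
  exact (cont_upper hf b).neg

lemma bdI_ca {g : ℝ → ℝ → ℂ} {M : ℝ} (h : SC g M) (b c d : ℝ) : Continuous fun a => bdI g a b c d := by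
  unfold bdI
  have := cont_lower (h.hx c) b
  have := cont_lower (h.hx d) b
  have := h.conty c d
  fun_prop

lemma bdI_cb {g : ℝ → ℝ → ℂ} {M : ℝ} (h : SC g M) (a c d : ℝ) : Continuous fun b => bdI g a b c d := by
  unfold bdI
  have := cont_upper (h.hx c) a
  have := cont_upper (h.hx d) a
  have := h.conty c d
  fun_prop

lemma bdI_cc {g : ℝ → ℝ → ℂ} {M : ℝ} (h : SC g M) (a b d : ℝ) : Continuous fun c => bdI g a b c d := by
  unfold bdI
  have := cont_lower (h.hy a) d
  have := cont_lower (h.hy b) d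
  have := h.contx a b
  fun_prop

lemma bdI_cd {g : ℝ → ℝ → ℂ} {M : ℝ} (h : SC g M) (a b c : ℝ) : Continuous fun d => bdI g a b c d := by
  unfold bdI
  have := cont_upper (h.hy a) c
  have := cont_upper (h.hy b) c
  have := h.contx a b
  fun_prop

lemma lim_l {φ : ℝ → ℂ} (hφ : Continuous φ) {a m : ℝ} (ham : a < m) (h : ∀ t ∈ Ioo a m, φ t = 0) :
    φ a = 0 := by
  have hc : IsClosed {t | φ t = 0} := isClosed_eq hφ continuous_const
  have : closure (Ioo a m) ⊆ {t | φ t = 0} := closure_minimal h hc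
  rw [closure_Ioo ham.ne] at this
  exact this ⟨le_rfl, ham.le⟩

lemma lim_r {φ : ℝ → ℂ} (hφ : Continuous φ) {m b : ℝ} (ham : m < b) (h : ∀ t ∈ Ioo m b, φ t = 0) :
    φ b = 0 := by
  have hc : IsClosed {t | φ t = 0} := isClosed_eq hφ continuous_const
  have : closure (Ioo m b) ⊆ {t | φ t = 0} := closure_minimal h hc
  rw [closure_Ioo ham.ne] at this
  exact this ⟨ham.le, le_rfl⟩

/-- The function on `ℂ`. -/
def toC (g : ℝ → ℝ → ℂ) : ℂ → ℂ := fun z => g z.re z.im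

lemma bdI_zero_closed (g : ℝ → ℝ → ℂ) {a b c d : ℝ} (hab : a ≤ b) (hcd : c ≤ d)
    (h : ∀ x ∈ Icc a b, ∀ y ∈ Icc c d, DifferentiableAt ℂ (toC g) ⟨x, y⟩) : bdI g a b c d = 0 := by
  have := Complex.integral_boundary_rect_eq_zero_of_differentiableOn (toC g) ⟨a, c⟩ ⟨b, d⟩ (by
    intro z hz
    rw [Complex.mem_reProdIm] at hz
    simp only [uIcc_of_le hab, uIcc_of_le hcd] at hz
    exact (h z.re hz.1 z.im hz.2).differentiableWithinAt)
  simpa [bdI, toC] using this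

lemma bdI_zero_open {g : ℝ → ℝ → ℂ} {M : ℝ} (hg : SC g M) {a b c d : ℝ} (hab : a ≤ b) (hcd : c ≤ d)
    (h : ∀ x ∈ Ioo a b, ∀ y ∈ Ioo c d, DifferentiableAt ℂ (toC g) ⟨x, y⟩) : bdI g a b c d = 0 := by
  rcases hab.eq_or_lt with rfl | hab
  · exact bdI_selfx _ _ _ _
  rcases hcd.eq_or_lt with rfl | hcd
  · exact bdI_selfy _ _ _ _
  obtain ⟨m, hm1, hm2⟩ := exists_between hab
  obtain ⟨n, hn1, hn2⟩ := exists_between hcd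
  apply lim_l (bdI_ca hg b c d) hm1
  intro a' ha'
  apply lim_r (bdI_cb hg a' c d) hm2
  intro b' hb'
  apply lim_l (bdI_cc hg a' b' d) hn1
  intro c' hc'
  apply lim_r (bdI_cd hg a' b' c') hn2
  intro d' hd'
  apply bdI_zero_closed g (ha'.2.trans hb'.1).le (hc'.2.trans hd'.1).le
  intro x hx y hy
  exact h x ⟨ha'.1.trans_le hx.1, hx.2.trans_lt hb'.2⟩ y ⟨hc'.1.trans_le hy.1, hy.2.trans_lt hd'.2⟩

lemma bisect (P : ℝ → ℝ → ℕ → Prop) (w h : ℝ) (hw : 0 ≤ w) (hh : 0 ≤ h)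
    (hstep : ∀ u v k, P u v (k+1) → P (u + w / 2^(k+1)) v (k+1) → P u (v + h / 2^(k+1)) (k+1) →
      P (u + w / 2^(k+1)) (v + h / 2^(k+1)) (k+1) → P u v k) (a c : ℝ)
    (hloc : ∀ x y, x ∈ Icc a (a+w) → y ∈ Icc c (c+h) → ∃ k0, ∀ k ≥ k0, ∀ u v,
      a ≤ u → u + w/2^k ≤ a + w → c ≤ v → v + h/2^k ≤ c + h → u ≤ x → x ≤ u + w/2^k →
      v ≤ y → y ≤ v + h/2^k → P u v k) : P a c 0 := by
  by_contra hP
  have step : ∀ (k : ℕ) (p : {p : ℝ × ℝ // ¬ P p.1 p.2 k}), ∃ q : {q : ℝ × ℝ // ¬ P q.1 q.2 (k+1)},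
      (q.1.1 = p.1.1 ∨ q.1.1 = p.1.1 + w / 2^(k+1)) ∧ (q.1.2 = p.1.2 ∨ q.1.2 = p.1.2 + h / 2^(k+1)) := by
    rintro k ⟨⟨u, v⟩, hp⟩
    by_contra hcon
    push Not at hcon
    apply hp
    apply hstep
    · by_contra h1; exact (hcon ⟨(u, v), h1⟩ (Or.inl rfl)).1 rfl
    · by_contra h1; exact (hcon ⟨(u + w / 2^(k+1), v), h1⟩ (Or.inr rfl)).1 rfl
    · by_contra h1; exact (hcon ⟨(u, v + h / 2^(k+1)), h1⟩ (Or.inl rfl)).2 rfl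
    · by_contra h1; exact (hcon ⟨(u + w / 2^(k+1), v + h / 2^(k+1)), h1⟩ (Or.inr rfl)).2 rfl
  choose nx hnx using step
  let S : (k : ℕ) → {p : ℝ × ℝ // ¬ P p.1 p.2 k} := fun k =>
    Nat.rec (motive := fun k => {p : ℝ × ℝ // ¬ P p.1 p.2 k}) ⟨(a, c), hP⟩ (fun k p => nx k p) k
  have hS : ∀ k, S (k+1) = nx k (S k) := fun k => rfl
  have aux : ∀ (u : ℕ → ℝ) (w : ℝ), 0 ≤ w → (∀ k, u (k+1) = u k ∨ u (k+1) = u k + w / 2^(k+1)) →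
      ∃ x, ∀ k, u 0 ≤ u k ∧ u k + w / 2^k ≤ u 0 + w ∧ u k ≤ x ∧ x ≤ u k + w / 2^k := by
    intro u w hw hu
    have h2 : ∀ k : ℕ, w / 2^k = w / 2^(k+1) + w / 2^(k+1) := by
      intro k; rw [pow_succ]; field_simp; ring
    have h0 : ∀ k : ℕ, 0 ≤ w / 2^k := fun k => by positivity
    have hm : Monotone u := by
      apply monotone_nat_of_le_succ
      intro k
      rcases hu k with h | h <;> rw [h]
      linarith [h0 (k+1)]
    have hA : Antitone (fun k => u k + w / 2^k) := by
      apply antitone_nat_of_succ_le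
      intro k
      have := h2 k
      have := h0 (k+1)
      rcases hu k with h | h <;> simp only [h] <;> linarith
    have hub : ∀ j k, u j ≤ u k + w / 2^k := by
      intro j k
      have e1 := hm (le_max_left j k)
      have e2 := hA (le_max_right j k)
      have := h0 (max j k)
      simp only at e2
      linarith
    have hbdd : BddAbove (range u) := ⟨u 0 + w / 2^0, by rintro _ ⟨j, rfl⟩; exact hub j 0⟩
    refine ⟨⨆ k, u k, fun k => ⟨hm (Nat.zero_le k), ?_, le_ciSup hbdd k, ciSup_le fun j => hub j k⟩⟩
    simpa using hA (Nat.zero_le k)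
  obtain ⟨x, hx⟩ := aux (fun k => (S k).1.1) w hw (fun k => (hnx k (S k)).1)
  obtain ⟨y, hy⟩ := aux (fun k => (S k).1.2) h hh (fun k => (hnx k (S k)).2)
  have hx0 := hx 0
  have hy0 := hy 0
  simp only [pow_zero, div_one] at hx0 hy0
  obtain ⟨k0, hk0⟩ := hloc x y ⟨hx0.2.2.1, hx0.2.2.2⟩ ⟨hy0.2.2.1, hy0.2.2.2⟩
  exact (S k0).2 (hk0 k0 le_rfl _ _ (hx k0).1 (hx k0).2.1 (hy k0).1 (hy k0).2.1 (hx k0).2.2.1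
    (hx k0).2.2.2 (hy k0).2.2.1 (hy k0).2.2.2)

end LM


namespace LM
open Set
open scoped NNReal

/-- The situation of the Looman–Menchoff argument after the Baire step. -/
structure Setup (g : ℝ → ℝ → ℂ) (F : Set (ℝ × ℝ)) (α β γ δ K M : ℝ) : Prop where
  sc : SC g M
  cl : IsClosed F
  hK : 0 ≤ K
  hol : ∀ x ∈ Ioo α β, ∀ y ∈ Ioo γ δ, (x, y) ∉ F → DifferentiableAt ℂ (toC g) ⟨x, y⟩
  cr : ∀ x ∈ Ioo α β, ∀ y ∈ Ioo γ δ, ∃ gx gy, HasDerivAt (fun s => g s y) gx x ∧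
    HasDerivAt (fun t => g x t) gy y ∧ gx + Complex.I * gy = 0
  cx : ∀ z ∈ F, z.1 ∈ Ioo α β → z.2 ∈ Ioo γ δ → ∀ s ∈ Ioo α β, ‖g s z.2 - g z.1 z.2‖ ≤ K * |s - z.1|
  cy : ∀ z ∈ F, z.1 ∈ Ioo α β → z.2 ∈ Ioo γ δ → ∀ t ∈ Ioo γ δ, ‖g z.1 t - g z.1 z.2‖ ≤ K * |t - z.2|

lemma exists_D {g : ℝ → ℝ → ℂ} {M K : ℝ} (hg : SC g M) (E : Set (ℝ × ℝ)) (hE : MeasurableSet E)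
    (hK : 0 ≤ K)
    (hd : ∀ z ∈ E, DifferentiableAt ℝ (fun s => g s z.2) z.1)
    (hl : ∀ z ∈ E, ∀ᶠ s in 𝓝 z.1, ‖g s z.2 - g z.1 z.2‖ ≤ K * ‖s - z.1‖) :
    ∃ D : ℝ × ℝ → ℂ, Measurable D ∧ (∀ p, ‖D p‖ ≤ K) ∧ (∀ p ∉ E, D p = 0) ∧
      ∀ z ∈ E, HasDerivAt (fun s => g s z.2) (D z) z.1 := by
  refine ⟨E.indicator fun p => deriv (fun s => g s p.2) p.1, ?_, ?_, ?_, ?_⟩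
  · apply measurable_of_tendsto_metrizable (f := fun (k : ℕ) => E.indicator fun p : ℝ × ℝ =>
      (((1 / ((k:ℝ) + 1))⁻¹ : ℝ) : ℂ) * (g (p.1 + 1 / ((k:ℝ) + 1)) p.2 - g p.1 p.2))
    · intro k
      refine Measurable.indicator ?_ hE
      refine Measurable.const_mul (Measurable.sub ?_ hg.meas) _
      exact hg.meas.comp (f := fun p : ℝ × ℝ => (p.1 + 1 / ((k:ℝ) + 1), p.2)) (by fun_prop)
    · rw [tendsto_pi_nhds]
      intro p
      by_cases hp : p ∈ E
      · simp only [indicator_of_mem hp]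
        have h1 := (hd p hp).hasDerivAt.tendsto_slope_zero
        have h2 : Tendsto (fun k : ℕ => 1 / ((k:ℝ) + 1)) atTop (𝓝[≠] 0) := by
          rw [tendsto_nhdsWithin_iff]
          refine ⟨tendsto_one_div_add_atTop_nhds_zero_nat, Eventually.of_forall fun k => ?_⟩
          have : (0:ℝ) < 1 / ((k:ℝ) + 1) := by positivity
          exact this.ne'
        have h3 := h1.comp h2
        refine h3.congr fun k => ?_
        simp
      · simp only [indicator_of_notMem hp]
        exact tendsto_const_nhds
  · intro p
    by_cases hp : p ∈ E
    · rw [indicator_of_mem hp]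
      exact (hd p hp).hasDerivAt.le_of_lip' hK (hl p hp)
    · rw [indicator_of_notMem hp]; simpa using hK
  · intro p hp; exact indicator_of_notMem hp _
  · intro z hz
    rw [indicator_of_mem hz]
    exact (hd z hz).hasDerivAt

lemma hull {g : ℝ → ℝ → ℂ} {F : Set (ℝ × ℝ)} {α β γ δ K M : ℝ} (S : Setup g F α β γ δ K M)
    {a b c d ρ : ℝ} (hab : a ≤ b) (hcd : c ≤ d) (hα : α < a) (hβ : b < β) (hγ : γ < c) (hδ : d < δ)
    (hρ : 0 ≤ ρ) (h1 : b - a ≤ ρ * (d - c)) (h2 : d - c ≤ ρ * (b - a)) :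
    ‖bdI g a b c d‖ ≤ 2 * (K * (3 + 3 * ρ)) *
      ∫ p in Icc a b ×ˢ Icc c d, Fᶜ.indicator (fun _ => (1:ℝ)) p := by
  have hIx : Icc a b ⊆ Ioo α β := fun x hx => ⟨hα.trans_le hx.1, hx.2.trans_lt hβ⟩
  have hIy : Icc c d ⊆ Ioo γ δ := fun x hx => ⟨hγ.trans_le hx.1, hx.2.trans_lt hδ⟩
  have hK := S.hK
  by_cases hne : (F ∩ Icc a b ×ˢ Icc c d).Nonempty
  swap
  · have : bdI g a b c d = 0 := by
      apply bdI_zero_closed g hab hcd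
      intro x hx y hy
      exact S.hol x (hIx hx) y (hIy hy) (fun h => hne ⟨(x, y), h, hx, hy⟩)
    rw [this, norm_zero]
    have : 0 ≤ ∫ p in Icc a b ×ˢ Icc c d, Fᶜ.indicator (fun _ => (1:ℝ)) p :=
      integral_nonneg fun p => indicator_nonneg (fun _ _ => zero_le_one) p
    positivity
  have hcomp : IsCompact (F ∩ Icc a b ×ˢ Icc c d) :=
    (isCompact_Icc.prod isCompact_Icc).inter_left S.cl
  obtain ⟨zl, hzl, hzl'⟩ := hcomp.exists_isMinOn hne continuous_fst.continuousOn
  obtain ⟨zr, hzr, hzr'⟩ := hcomp.exists_isMaxOn hne continuous_fst.continuousOn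
  obtain ⟨zb, hzb, hzb'⟩ := hcomp.exists_isMinOn hne continuous_snd.continuousOn
  obtain ⟨zt, hzt, hzt'⟩ := hcomp.exists_isMaxOn hne continuous_snd.continuousOn
  rw [isMinOn_iff] at hzl' hzb'
  rw [isMaxOn_iff] at hzr' hzt'
  obtain ⟨a', yl⟩ := zl
  obtain ⟨b', yr⟩ := zr
  obtain ⟨xb, c'⟩ := zb
  obtain ⟨xt, d'⟩ := zt
  simp only at hzl' hzr' hzb' hzt'
  obtain ⟨fl, ⟨hl1, hl2⟩⟩ := hzl
  obtain ⟨fr, ⟨hr1, hr2⟩⟩ := hzr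
  obtain ⟨fb, ⟨hb1, hb2⟩⟩ := hzb
  obtain ⟨ft, ⟨ht1, ht2⟩⟩ := hzt
  simp only at hl1 hl2 hr1 hr2 hb1 hb2 ht1 ht2
  have hE : ∀ z ∈ F, z.1 ∈ Icc a b → z.2 ∈ Icc c d → z.1 ∈ Icc a' b' ∧ z.2 ∈ Icc c' d' :=
    fun z hz hz1 hz2 => ⟨⟨hzl' z ⟨hz, hz1, hz2⟩, hzr' z ⟨hz, hz1, hz2⟩⟩,
      hzb' z ⟨hz, hz1, hz2⟩, hzt' z ⟨hz, hz1, hz2⟩⟩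
  have hab' : a' ≤ b' := (hE _ fl hl1 hl2).1.2
  have hcd' : c' ≤ d' := (hE _ fb hb1 hb2).2.2
  -- measurable derivative functions
  have hWm : MeasurableSet (F ∩ Ioo α β ×ˢ Ioo γ δ) :=
    S.cl.measurableSet.inter (measurableSet_Ioo.prod measurableSet_Ioo)
  obtain ⟨Dx, hDx1, hDx2, hDx3, hDx4⟩ := exists_D (K := K) S.sc _ hWm hK
    (fun z hz => by
      obtain ⟨gx, gy, e, _⟩ := S.cr z.1 hz.2.1 z.2 hz.2.2
      exact e.differentiableAt)
    (fun z hz => by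
      filter_upwards [isOpen_Ioo.mem_nhds hz.2.1] with s hs
      exact S.cx z hz.1 hz.2.1 hz.2.2 s hs)
  have hWm' : MeasurableSet (Prod.swap ⁻¹' (F ∩ Ioo α β ×ˢ Ioo γ δ)) := measurable_swap hWm
  obtain ⟨Dy, hDy1, hDy2, hDy3, hDy4⟩ := exists_D (K := K) S.sc.swap _ hWm' hK
    (fun z hz => by
      obtain ⟨gx, gy, _, e, _⟩ := S.cr z.2 hz.2.1 z.1 hz.2.2
      exact e.differentiableAt)
    (fun z hz => by
      filter_upwards [isOpen_Ioo.mem_nhds hz.2.2] with s hs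
      exact S.cy (z.2, z.1) hz.1 hz.2.1 hz.2.2 s hs)
  have hDD : ∀ p, Complex.I * Dx p = Dy p.swap := by
    intro p
    by_cases hp : p ∈ F ∩ Ioo α β ×ˢ Ioo γ δ
    · obtain ⟨gx, gy, e1, e2, e3⟩ := S.cr p.1 hp.2.1 p.2 hp.2.2
      have f1 := (hDx4 p hp).unique e1
      have f2 := (hDy4 p.swap (by rw [mem_preimage, Prod.swap_swap]; exact hp)).unique e2
      rw [f1, f2]
      have : gx = - (Complex.I * gy) := eq_neg_of_add_eq_zero_left e3
      rw [this]
      linear_combination (-gy) * Complex.I_mul_I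
    · rw [hDx3 p hp, hDy3 p.swap (by rw [mem_preimage, Prod.swap_swap]; exact hp), mul_zero]
  have H1 := half S.sc F S.cl (fun p => Dy p.swap) (hDy1.comp measurable_swap) K hK (fun p => hDy2 _)
    (fun p hp => hDy3 _ (fun h => hp (by simpa using h.1)))
    a b c d a' b' c' d' ρ hl1.1 hab' hr1.2 hb2.1 hcd' ht2.2 hρ h1 hE xt xb ht1 hb1 ft fb
    (fun z hz hz1 hz2 s hs => S.cx z hz (hIx hz1) (hIy hz2) s (hIx hs))
    (fun z hz hz1 hz2 s hs => S.cy z hz (hIx hz1) (hIy hz2) s (hIy hs))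
    (fun z hz hz1 hz2 => hDy4 z.swap ⟨by simpa using hz, by simpa using hIx hz1, by simpa using hIy hz2⟩)
  have H2 := half S.sc.swap (Prod.swap ⁻¹' F) (S.cl.preimage continuous_swap)
    (fun p => Dx p.swap) (hDx1.comp measurable_swap) K hK (fun p => hDx2 _)
    (fun p hp => hDx3 _ (fun h => hp h.1))
    c d a b c' d' a' b' ρ hb2.1 hcd' ht2.2 hl1.1 hab' hr1.2 hρ h2
    (fun z hz hz1 hz2 => (hE z.swap hz hz2 hz1).symm) yr yl hr2 hl2 fr fl
    (fun z hz hz1 hz2 s hs => S.cy z.swap hz (hIx hz2) (hIy hz1) s (hIy hs))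
    (fun z hz hz1 hz2 s hs => S.cx z.swap hz (hIx hz2) (hIy hz1) s (hIx hs))
    (fun z hz hz1 hz2 => hDx4 z.swap ⟨hz, hIx hz2, hIy hz1⟩)
  have sw1 : ∫ p in Icc c d ×ˢ Icc a b, Dx p.swap = ∫ p in Icc a b ×ˢ Icc c d, Dx p := by
    rw [Measure.volume_eq_prod]
    exact setIntegral_prod_swap (μ := (volume : Measure ℝ)) (ν := (volume : Measure ℝ)) (Icc a b) (Icc c d) Dx
  have sw2 : ∫ p in Icc c d ×ˢ Icc a b, (Prod.swap ⁻¹' F)ᶜ.indicator (fun _ => (1:ℝ)) p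
      = ∫ p in Icc a b ×ˢ Icc c d, Fᶜ.indicator (fun _ => (1:ℝ)) p := by
    rw [Measure.volume_eq_prod]
    exact setIntegral_prod_swap (μ := (volume : Measure ℝ)) (ν := (volume : Measure ℝ)) (Icc a b) (Icc c d) (Fᶜ.indicator (fun _ => (1:ℝ)))
  rw [sw1, sw2] at H2
  -- replace by the hull
  have hz1 : bdI g a a' c d = 0 := by
    apply bdI_zero_open S.sc hl1.1 hcd
    intro x hx y hy
    have hx' : x ∈ Icc a b := ⟨hx.1.le, hx.2.le.trans hl1.2⟩
    have hy' : y ∈ Icc c d := ⟨hy.1.le, hy.2.le⟩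
    exact S.hol x (hIx hx') y (hIy hy') fun h => absurd (hE _ h hx' hy').1.1 (not_le.2 hx.2)
  have hz2 : bdI g b' b c d = 0 := by
    apply bdI_zero_open S.sc hr1.2 hcd
    intro x hx y hy
    have hx' : x ∈ Icc a b := ⟨hr1.1.trans hx.1.le, hx.2.le⟩
    have hy' : y ∈ Icc c d := ⟨hy.1.le, hy.2.le⟩
    exact S.hol x (hIx hx') y (hIy hy') fun h => absurd (hE _ h hx' hy').1.2 (not_le.2 hx.1)
  have hz3 : bdI g a' b' c c' = 0 := by
    apply bdI_zero_open S.sc hab' hb2.1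
    intro x hx y hy
    have hx' : x ∈ Icc a b := ⟨hl1.1.trans hx.1.le, hx.2.le.trans hr1.2⟩
    have hy' : y ∈ Icc c d := ⟨hy.1.le, hy.2.le.trans hb2.2⟩
    exact S.hol x (hIx hx') y (hIy hy') fun h => absurd (hE _ h hx' hy').2.1 (not_le.2 hy.2)
  have hz4 : bdI g a' b' d' d = 0 := by
    apply bdI_zero_open S.sc hab' ht2.2
    intro x hx y hy
    have hx' : x ∈ Icc a b := ⟨hl1.1.trans hx.1.le, hx.2.le.trans hr1.2⟩
    have hy' : y ∈ Icc c d := ⟨ht2.1.trans hy.1.le, hy.2.le⟩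
    exact S.hol x (hIx hx') y (hIy hy') fun h => absurd (hE _ h hx' hy').2.2 (not_le.2 hy.1)
  have hA : bdI g a b c d = bdI g a' b' c' d' := by
    rw [bdI_addx S.sc a a' b c d, bdI_addx S.sc a' b' b c d, bdI_addy S.sc a' b' c c' d,
      bdI_addy S.sc a' b' c' d' d, hz1, hz2, hz3, hz4]
    ring
  have hIntEq : Complex.I * ∫ p in Icc a b ×ˢ Icc c d, Dx p = ∫ p in Icc a b ×ˢ Icc c d, Dy p.swap := by
    rw [← integral_const_mul]
    congr 1
    funext p
    exact hDD p
  have hA2 : bdI g a' b' c' d' =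
      Complex.I * ((∫ y in c'..d', (g b' y - g a' y)) - ∫ p in Icc a b ×ˢ Icc c d, Dx p)
      - ((∫ x in a'..b', (g x d' - g x c')) - ∫ p in Icc a b ×ˢ Icc c d, Dy p.swap) := by
    rw [← hIntEq, intervalIntegral.integral_sub (S.sc.iiy _ _ _) (S.sc.iiy _ _ _),
      intervalIntegral.integral_sub (S.sc.iix _ _ _) (S.sc.iix _ _ _)]
    unfold bdI
    ring
  rw [hA, hA2]
  refine (norm_sub_le _ _).trans ?_
  rw [norm_mul, Complex.norm_I, one_mul]
  linarith

end LM


namespace LM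
open Set
open scoped NNReal

lemma Ioc_split (a s : ℝ) (hs : 0 ≤ s) : Ioc a (a + 2 * s) = Ioc a (a + s) ∪ Ioc (a + s) (a + s + s) := by
  rw [Ioc_union_Ioc_eq_Ioc (by linarith) (by linarith)]
  congr 1; ring

lemma meas_split (μ : Measure (ℝ × ℝ)) [IsFiniteMeasure μ] (u v s t : ℝ) (hs : 0 ≤ s) (ht : 0 ≤ t) :
    μ.real (Ioc u (u + 2 * s) ×ˢ Ioc v (v + 2 * t)) =
      μ.real (Ioc u (u + s) ×ˢ Ioc v (v + t)) + μ.real (Ioc (u+s) (u + s + s) ×ˢ Ioc v (v + t))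
      + (μ.real (Ioc u (u + s) ×ˢ Ioc (v+t) (v + t + t))
        + μ.real (Ioc (u+s) (u + s + s) ×ˢ Ioc (v+t) (v + t + t))) := by
  have d1 : ∀ a s : ℝ, Disjoint (Ioc a (a + s)) (Ioc (a + s) (a + s + s)) := by
    intro a s
    rw [Set.disjoint_left]
    intro x hx hx'
    exact absurd hx'.1 (not_lt.2 hx.2)
  rw [Ioc_split v t ht, prod_union, measureReal_union, Ioc_split u s hs, union_prod, union_prod,
    measureReal_union, measureReal_union]
  · exact Disjoint.set_prod_left (d1 _ _) _ _
  · exact measurableSet_Ioc.prod measurableSet_Ioc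
  · exact Disjoint.set_prod_left (d1 _ _) _ _
  · exact measurableSet_Ioc.prod measurableSet_Ioc
  · exact Disjoint.set_prod_right (d1 _ _) _ _
  · exact measurableSet_Ioc.prod measurableSet_Ioc

lemma Setup.bdI_le {g : ℝ → ℝ → ℂ} {F : Set (ℝ × ℝ)} {α β γ δ K M : ℝ} (S : Setup g F α β γ δ K M)
    {a c w h ρ ε : ℝ} (hw : 0 < w) (hh : 0 < h) (hα : α < a) (hβ : a + w < β) (hγ : γ < c)
    (hδ : c + h < δ) (hρ : 0 ≤ ρ) (h1 : w ≤ ρ * h) (h2 : h ≤ ρ * w) (hε : 0 < ε) :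
    ‖bdI g a (a + w) c (c + h)‖ ≤ 2 * (K * (3 + 3 * ρ)) * ε := by
  have hK := S.hK
  set C := 2 * (K * (3 + 3 * ρ)) with hC
  have hC0 : 0 ≤ C := by positivity
  have hcomp : IsCompact (F ∩ Icc a (a+w) ×ˢ Icc c (c+h)) :=
    (isCompact_Icc.prod isCompact_Icc).inter_left S.cl
  obtain ⟨O, hO1, hO2, hO3⟩ := hcomp.exists_isOpen_lt_add (μ := (volume : Measure (ℝ × ℝ)))
    (ε := ENNReal.ofReal ε) (by simpa using hε)
  have hvol : volume (O \ F) ≤ ENNReal.ofReal ε := by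
    have e1 : volume (O \ (F ∩ Icc a (a+w) ×ˢ Icc c (c+h))) =
        volume O - volume (F ∩ Icc a (a+w) ×ˢ Icc c (c+h)) :=
      measure_sdiff hO1 hcomp.measurableSet.nullMeasurableSet hcomp.measure_lt_top.ne
    refine (measure_mono (sdiff_subset_sdiff_right
      (inter_subset_left (t := Icc a (a+w) ×ˢ Icc c (c+h))))).trans ?_
    rw [e1, tsub_le_iff_left]
    exact hO3.le
  set μ : Measure (ℝ × ℝ) := volume.restrict (O \ F) with hμ
  have : IsFiniteMeasure μ := ⟨by rw [hμ, Measure.restrict_apply_univ]; exact hvol.trans_lt ENNReal.ofReal_lt_top⟩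
  have key := bisect (fun u v k => ‖bdI g u (u + w/2^k) v (v + h/2^k)‖ ≤
    C * μ.real (Ioc u (u + w/2^k) ×ˢ Ioc v (v + h/2^k))) w h hw.le hh.le ?_ a c ?_
  · simp only [pow_zero, div_one] at key
    refine key.trans (mul_le_mul_of_nonneg_left ?_ hC0)
    refine ENNReal.toReal_le_of_le_ofReal hε.le ?_
    refine (measure_mono (subset_univ _)).trans ?_
    rw [hμ, Measure.restrict_apply_univ]
    exact hvol
  · intro u v k p1 p2 p3 p4
    have hs : w / 2^k = 2 * (w / 2^(k+1)) := by rw [pow_succ]; field_simp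
    have ht : h / 2^k = 2 * (h / 2^(k+1)) := by rw [pow_succ]; field_simp
    have hs0 : 0 ≤ w / 2^(k+1) := by positivity
    have ht0 : 0 ≤ h / 2^(k+1) := by positivity
    rw [hs, ht]
    generalize w / 2^(k+1) = s at *
    generalize h / 2^(k+1) = t at *
    rw [meas_split μ u v s t hs0 ht0]
    rw [bdI_addx S.sc u (u+s), bdI_addy S.sc u (u+s) v (v+t), bdI_addy S.sc (u+s) _ v (v+t)]
    have e1 : u + 2 * s = u + s + s := by ring
    have e2 : v + 2 * t = v + t + t := by ring
    rw [e1, e2]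
    refine (norm_add_le _ _).trans ?_
    have := norm_add_le (bdI g u (u + s) v (v + t)) (bdI g u (u + s) (v + t) (v + t + t))
    have := norm_add_le (bdI g (u + s) (u + s + s) v (v + t)) (bdI g (u + s) (u + s + s) (v + t) (v + t + t))
    linarith
  · intro x y hx hy
    have hsmall : ∀ U : Set (ℝ × ℝ), IsOpen U → (x, y) ∈ U → ∃ k0 : ℕ, ∀ k ≥ k0, ∀ u v,
        u ≤ x → x ≤ u + w/2^k → v ≤ y → y ≤ v + h/2^k →
        Icc u (u + w/2^k) ×ˢ Icc v (v + h/2^k) ⊆ U := by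
      intro U hU hxy
      obtain ⟨r, hr, hrU⟩ := Metric.isOpen_iff.1 hU _ hxy
      have tw : ∀ w : ℝ, Tendsto (fun k : ℕ => w / 2^k) atTop (𝓝 0) := by
        intro w
        have := (tendsto_pow_atTop_nhds_zero_of_lt_one (r := (1/2 : ℝ)) (by norm_num) (by norm_num)).const_mul w
        simp only [mul_zero] at this
        refine this.congr fun k => ?_
        rw [div_pow, one_pow]; ring
      obtain ⟨k0, hk0⟩ := eventually_atTop.1
        (((tw w).eventually_lt_const hr).and ((tw h).eventually_lt_const hr))
      refine ⟨k0, fun k hk u v q1 q2 q3 q4 p hp => hrU ?_⟩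
      obtain ⟨i1, i2⟩ := hk0 k hk
      obtain ⟨⟨j1, j2⟩, j3, j4⟩ := hp
      rw [Metric.mem_ball, Prod.dist_eq, max_lt_iff, Real.dist_eq, Real.dist_eq, abs_lt, abs_lt]
      refine ⟨⟨?_, ?_⟩, ?_, ?_⟩ <;> simp only <;> linarith
    by_cases hF : (x, y) ∈ F
    · obtain ⟨k0, hk0⟩ := hsmall O hO2 (hO1 ⟨hF, hx, hy⟩)
      refine ⟨k0, fun k hk u v b1 b2 b3 b4 b5 b6 b7 b8 => ?_⟩
      have hR := hk0 k hk u v b5 b6 b7 b8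
      have hws : 0 < w / 2^k := by positivity
      have hhs : 0 < h / 2^k := by positivity
      have := hull S (a := u) (b := u + w/2^k) (c := v) (d := v + h/2^k) (ρ := ρ)
        (by linarith) (by linarith) (by linarith) (by linarith) (by linarith) (by linarith) hρ
        (by rw [add_sub_cancel_left, add_sub_cancel_left, mul_div_assoc']; gcongr)
        (by rw [add_sub_cancel_left, add_sub_cancel_left, mul_div_assoc']; gcongr)
      refine this.trans (le_of_eq ?_)
      congr 1
      have e1 : (fun _ : ℝ × ℝ => (1:ℝ)) = 1 := rfl
      rw [e1, integral_indicator_one S.cl.measurableSet.compl]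
      have e2 : (volume.restrict (Icc u (u + w/2^k) ×ˢ Icc v (v + h/2^k)) : Measure (ℝ × ℝ)) =
          volume.restrict (Ioc u (u + w/2^k) ×ˢ Ioc v (v + h/2^k)) := by
        apply Measure.restrict_congr_set
        rw [Measure.volume_eq_prod]
        exact (Measure.set_prod_ae_eq Ioc_ae_eq_Icc Ioc_ae_eq_Icc).symm
      rw [e2, measureReal_restrict_apply S.cl.measurableSet.compl, hμ,
        measureReal_restrict_apply (measurableSet_Ioc.prod measurableSet_Ioc)]
      congr 1
      ext p
      constructor
      · rintro ⟨i1, i2⟩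
        exact ⟨i2, hR ⟨Ioc_subset_Icc_self i2.1, Ioc_subset_Icc_self i2.2⟩, i1⟩
      · rintro ⟨i1, i2⟩
        exact ⟨i2.2, i1⟩
    · obtain ⟨k0, hk0⟩ := hsmall Fᶜ S.cl.isOpen_compl hF
      refine ⟨k0, fun k hk u v b1 b2 b3 b4 b5 b6 b7 b8 => ?_⟩
      have hR := hk0 k hk u v b5 b6 b7 b8
      have hws : 0 < w / 2^k := by positivity
      have hhs : 0 < h / 2^k := by positivity
      have : bdI g u (u + w/2^k) v (v + h/2^k) = 0 := by
        apply bdI_zero_closed g (by linarith) (by linarith)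
        intro x' hx' y' hy'
        refine S.hol x' ⟨?_, ?_⟩ y' ⟨?_, ?_⟩ (hR ⟨hx', hy'⟩)
        · linarith [hx'.1]
        · linarith [hx'.2]
        · linarith [hy'.1]
        · linarith [hy'.2]
      rw [this, norm_zero]
      positivity

lemma Setup.bdI_zero {g : ℝ → ℝ → ℂ} {F : Set (ℝ × ℝ)} {α β γ δ K M : ℝ} (S : Setup g F α β γ δ K M)
    {a b c d : ℝ} (hab : a ≤ b) (hcd : c ≤ d) (hα : α < a) (hβ : b < β) (hγ : γ < c)
    (hδ : d < δ) : bdI g a b c d = 0 := by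
  rcases hab.eq_or_lt with rfl | hab
  · exact bdI_selfx _ _ _ _
  rcases hcd.eq_or_lt with rfl | hcd
  · exact bdI_selfy _ _ _ _
  have hK := S.hK
  have hw : 0 < b - a := sub_pos.2 hab
  have hh : 0 < d - c := sub_pos.2 hcd
  set ρ := (b - a) / (d - c) + (d - c) / (b - a) with hρ
  have hρ0 : 0 ≤ ρ := by positivity
  have key : ∀ ε > 0, ‖bdI g a b c d‖ ≤ 2 * (K * (3 + 3 * ρ)) * ε := by
    intro ε hε
    have := S.bdI_le (a := a) (c := c) (w := b - a) (h := d - c) (ρ := ρ) hw hh hα (by linarith) hγ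
      (by linarith) hρ0 (by
        have : (b - a) = (b - a) / (d - c) * (d - c) := by field_simp
        have h3 : 0 ≤ (d - c) / (b - a) * (d - c) := by positivity
        rw [hρ, add_mul]; linarith) (by
        have : (d - c) = (d - c) / (b - a) * (b - a) := by field_simp
        have h3 : 0 ≤ (b - a) / (d - c) * (b - a) := by positivity
        rw [hρ, add_mul]; linarith) hε
    rwa [add_sub_cancel, add_sub_cancel] at this
  have hC0 : 0 ≤ 2 * (K * (3 + 3 * ρ)) := by positivity
  rw [← norm_le_zero_iff]
  refine le_of_forall_pos_le_add fun ε hε => ?_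
  have := key (ε / (2 * (K * (3 + 3 * ρ)) + 1)) (by positivity)
  rw [zero_add]
  refine this.trans ?_
  rw [mul_div_assoc', div_le_iff₀ (by positivity)]
  nlinarith

end LM


namespace LM
open Set
open scoped NNReal

lemma bdI_swapx (g : ℝ → ℝ → ℂ) (a b c d : ℝ) : bdI g b a c d = - bdI g a b c d := by
  unfold bdI
  rw [intervalIntegral.integral_symm a b, intervalIntegral.integral_symm a b]
  ring

lemma bdI_swapy (g : ℝ → ℝ → ℂ) (a b c d : ℝ) : bdI g a b d c = - bdI g a b c d := by
  unfold bdI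
  rw [intervalIntegral.integral_symm c d, intervalIntegral.integral_symm c d]
  ring

lemma SC.fubini {g : ℝ → ℝ → ℂ} {M : ℝ} (hg : SC g M) (a b c d : ℝ) :
    ∫ x in a..b, ∫ y in c..d, g x y = ∫ y in c..d, ∫ x in a..b, g x y := by
  apply intervalIntegral_intervalIntegral_swap
  apply Measure.integrableOn_of_bounded (M := M)
  · refine ((measure_mono (Set.prod_mono uIoc_subset_uIcc uIoc_subset_uIcc)).trans_lt
      (isCompact_uIcc.prod isCompact_uIcc).measure_lt_top).ne
  · exact hg.meas.aestronglyMeasurable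
  · exact Eventually.of_forall fun p => hg.hb _ _

lemma morera {g : ℝ → ℝ → ℂ} {M : ℝ} (hg : SC g M) {α β γ δ : ℝ}
    (hz : ∀ a b c d, a ≤ b → c ≤ d → α < a → b < β → γ < c → d < δ → bdI g a b c d = 0)
    {x0 y0 : ℝ} (hx0 : x0 ∈ Ioo α β) (hy0 : y0 ∈ Ioo γ δ) :
    DifferentiableAt ℂ (toC g) ⟨x0, y0⟩ := by
  have hz' : ∀ a ∈ Ioo α β, ∀ b ∈ Ioo α β, ∀ c ∈ Ioo γ δ, ∀ d ∈ Ioo γ δ, bdI g a b c d = 0 := by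
    have h1 : ∀ a ∈ Ioo α β, ∀ b ∈ Ioo α β, ∀ c ∈ Ioo γ δ, ∀ d ∈ Ioo γ δ, a ≤ b → bdI g a b c d = 0 := by
      intro a ha b hb c hc d hd hab
      rcases le_total c d with h | h
      · exact hz a b c d hab h ha.1 hb.2 hc.1 hd.2
      · rw [bdI_swapy, hz a b d c hab h ha.1 hb.2 hd.1 hc.2, neg_zero]
    intro a ha b hb c hc d hd
    rcases le_total a b with h | h
    · exact h1 a ha b hb c hc d hd h
    · rw [bdI_swapx, h1 b hb a ha c hc d hd h, neg_zero]
  have hM : 0 ≤ M := (norm_nonneg _).trans (hg.hb 0 0)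
  set F : ℝ → ℝ → ℂ := fun x y => (∫ t in x0..x, g t y0) + Complex.I * ∫ s in y0..y, g x s with hF
  have hA : ∀ x c d, F x d - F x c = Complex.I * ∫ s in c..d, g x s := by
    intro x c d
    rw [hF]
    simp only
    rw [← intervalIntegral.integral_add_adjacent_intervals (hg.iiy x y0 c) (hg.iiy x c d)]
    ring
  have hB : ∀ a ∈ Ioo α β, ∀ b ∈ Ioo α β, ∀ y ∈ Ioo γ δ, F b y - F a y = ∫ t in a..b, g t y := by
    intro a ha b hb y hy
    have h1 := hz' a ha b hb y0 hy0 y hy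
    have h2 := intervalIntegral.integral_add_adjacent_intervals (hg.iix y0 x0 a) (hg.iix y0 a b)
    rw [hF]
    simp only
    rw [← h2]
    unfold bdI at h1
    linear_combination h1
  set U : Set ℂ := Ioo α β ×ℂ Ioo γ δ with hU
  have hUo : IsOpen U := isOpen_Ioo.reProdIm isOpen_Ioo
  have hcont : ContinuousOn (toC F) U := by
    intro z hz
    have hz2 := Complex.mem_reProdIm.1 hz
    have key : ∀ w ∈ U, ‖toC F w - toC F z‖ ≤ M * |w.re - z.re| + M * |w.im - z.im| := by
      intro w hw
      have hw2 := Complex.mem_reProdIm.1 hw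
      have e : toC F w - toC F z = (∫ t in z.re..w.re, g t z.im) + Complex.I * ∫ s in z.im..w.im, g w.re s := by
        rw [← hA, ← hB _ hz2.1 _ hw2.1 _ hz2.2]
        unfold toC; ring
      rw [e]
      refine (norm_add_le _ _).trans ?_
      rw [norm_mul, Complex.norm_I, one_mul]
      gcongr
      · exact intervalIntegral.norm_integral_le_of_norm_le_const fun x _ => hg.hb _ _
      · exact intervalIntegral.norm_integral_le_of_norm_le_const fun x _ => hg.hb _ _
    rw [ContinuousWithinAt, tendsto_iff_norm_sub_tendsto_zero]
    refine squeeze_zero' (Eventually.of_forall fun _ => norm_nonneg _)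
      (eventually_mem_nhdsWithin.mono key) ?_
    have : Continuous fun w : ℂ => M * |w.re - z.re| + M * |w.im - z.im| := by fun_prop
    have h3 := this.tendsto z
    simp only [sub_self, abs_zero, mul_zero, add_zero] at h3
    exact h3.mono_left nhdsWithin_le_nhds
  have hcons : Complex.IsConservativeOn (toC F) U := by
    intro z w hzw
    have hmem : ∀ x ∈ uIcc z.re w.re, ∀ y ∈ uIcc z.im w.im, x ∈ Ioo α β ∧ y ∈ Ioo γ δ := by
      intro x hx y hy
      exact Complex.mem_reProdIm.1 (hzw (show (⟨x, y⟩ : ℂ) ∈ _ from ⟨hx, hy⟩))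
    obtain ⟨hzr, hzi⟩ := hmem z.re left_mem_uIcc z.im left_mem_uIcc
    obtain ⟨hwr, hwi⟩ := hmem w.re right_mem_uIcc w.im right_mem_uIcc
    rw [← add_eq_zero_iff_eq_neg, Complex.wedgeIntegral_add_wedgeIntegral_eq]
    simp only [toC, Complex.add_re, Complex.ofReal_re, Complex.mul_re, Complex.I_re, mul_zero,
      Complex.ofReal_im, Complex.I_im, mul_one, sub_self, add_zero, Complex.add_im, Complex.mul_im,
      zero_add, smul_eq_mul]
    have cF1 : ∀ y ∈ uIcc z.im w.im, IntervalIntegrable (fun x => F x y) volume z.re w.re := by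
      intro y hy
      apply ContinuousOn.intervalIntegrable
      refine hcont.comp (f := fun x : ℝ => (⟨x, y⟩ : ℂ)) ?_ ?_
      · have : (fun x : ℝ => (⟨x, y⟩ : ℂ)) = fun x : ℝ => (x : ℂ) + y * Complex.I := by
          funext x; apply Complex.ext <;> simp
        rw [this]; fun_prop
      · intro x hx; exact Complex.mem_reProdIm.2 (hmem x hx y hy)
    have cF2 : ∀ x ∈ uIcc z.re w.re, IntervalIntegrable (fun y => F x y) volume z.im w.im := by
      intro x hx
      apply ContinuousOn.intervalIntegrable
      refine hcont.comp (f := fun y : ℝ => (⟨x, y⟩ : ℂ)) ?_ ?_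
      · have : (fun y : ℝ => (⟨x, y⟩ : ℂ)) = fun y : ℝ => (x : ℂ) + y * Complex.I := by
          funext x; apply Complex.ext <;> simp
        rw [this]; fun_prop
      · intro y hy; exact Complex.mem_reProdIm.2 (hmem x hx y hy)
    have i1 : (∫ x in z.re..w.re, F x w.im) - (∫ x in z.re..w.re, F x z.im) =
        Complex.I * ∫ x in z.re..w.re, ∫ s in z.im..w.im, g x s := by
      rw [← intervalIntegral.integral_sub (cF1 _ right_mem_uIcc) (cF1 _ left_mem_uIcc),
        ← intervalIntegral.integral_const_mul]
      simp only [hA]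
    have i2 : (∫ y in z.im..w.im, F w.re y) - (∫ y in z.im..w.im, F z.re y) =
        ∫ y in z.im..w.im, ∫ t in z.re..w.re, g t y := by
      rw [← intervalIntegral.integral_sub (cF2 _ right_mem_uIcc) (cF2 _ left_mem_uIcc)]
      apply intervalIntegral.integral_congr
      intro y hy
      exact hB _ hzr _ hwr _ (hmem _ left_mem_uIcc y hy).2
    have i3 := hg.fubini z.re w.re z.im w.im
    rw [i3] at i1
    linear_combination Complex.I * i2 - i1
  have hdiff : DifferentiableOn ℂ (toC F) U :=
    (Complex.isConservativeOn_and_continuousOn_iff_isDifferentiableOn hUo).1 ⟨hcons, hcont⟩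
  have hder : ∀ z ∈ U, deriv (toC F) z = toC g z := by
    intro z hz
    have hz2 := Complex.mem_reProdIm.1 hz
    have h1 := (hdiff.differentiableAt (hUo.mem_nhds hz)).hasDerivAt
    have h2 : HasDerivAt (fun s : ℝ => F s z.im) (deriv (toC F) z) z.re := by
      have hl : HasDerivAt (fun s : ℝ => (s : ℂ) + z.im * Complex.I) 1 z.re := by
        simpa using (Complex.ofRealCLM.hasDerivAt (x := z.re)).add_const (z.im * Complex.I)
      have h1' : HasDerivAt (toC F) (deriv (toC F) z) ((z.re : ℂ) + z.im * Complex.I) := by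
        rw [Complex.re_add_im]; exact h1
      have := h1'.scomp z.re hl
      rw [one_smul] at this
      refine this.congr_of_eventuallyEq (Eventually.of_forall fun s => ?_)
      simp [toC]
    have h3 : HasDerivAt (fun s : ℝ => F s z.im) (toC g z) z.re := by
      have : HasDerivAt (fun s : ℝ => F z.re z.im + ∫ t in z.re..s, g t z.im) (toC g z) z.re :=
        (intervalIntegral.integral_hasDerivAt_right (hg.iix _ _ _)
          ((hg.hx _).stronglyMeasurableAtFilter _ _) (hg.hx _).continuousAt).const_add _
      refine this.congr_of_eventuallyEq ?_
      filter_upwards [isOpen_Ioo.mem_nhds hz2.1] with s hs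
      rw [← hB _ hz2.1 _ hs _ hz2.2]; ring
    exact h2.unique h3
  have hmem0 : (⟨x0, y0⟩ : ℂ) ∈ U := Complex.mem_reProdIm.2 ⟨hx0, hy0⟩
  have h4 := (hdiff.deriv hUo).differentiableAt (hUo.mem_nhds hmem0)
  refine h4.congr_of_eventuallyEq ?_
  filter_upwards [hUo.mem_nhds hmem0] with z hz
  exact (hder z hz).symm

lemma Setup.diff {g : ℝ → ℝ → ℂ} {F : Set (ℝ × ℝ)} {α β γ δ K M : ℝ} (S : Setup g F α β γ δ K M)
    {x y : ℝ} (hx : x ∈ Ioo α β) (hy : y ∈ Ioo γ δ) : DifferentiableAt ℂ (toC g) ⟨x, y⟩ :=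
  morera S.sc (fun _ _ _ _ h1 h2 h3 h4 h5 h6 => S.bdI_zero h1 h2 h3 h4 h5 h6) hx hy

end LM


namespace LM
open Set
open scoped NNReal

/-- Existence of partial derivatives satisfying the Cauchy-Riemann equation at a point. -/
def CRAt (g : ℝ → ℝ → ℂ) (x y : ℝ) : Prop :=
  ∃ gx gy, HasDerivAt (fun s => g s y) gx x ∧ HasDerivAt (fun t => g x t) gy y ∧
    gx + Complex.I * gy = 0

lemma CRAt.cx {g : ℝ → ℝ → ℂ} {x y : ℝ} (h : CRAt g x y) : ContinuousAt (fun s => g s y) x := by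
  obtain ⟨gx, gy, h1, h2, _⟩ := h
  exact h1.continuousAt

lemma CRAt.cy {g : ℝ → ℝ → ℂ} {x y : ℝ} (h : CRAt g x y) : ContinuousAt (fun t => g x t) y := by
  obtain ⟨gx, gy, h1, h2, _⟩ := h
  exact h2.continuousAt

lemma mem_cb {a b r : ℝ} {p : ℝ × ℝ} :
    (a, b) ∈ Metric.closedBall p r ↔ |a - p.1| ≤ r ∧ |b - p.2| ≤ r := by
  rw [Metric.mem_closedBall, Prod.dist_eq, max_le_iff, Real.dist_eq, Real.dist_eq]

lemma mem_cb' {z p : ℝ × ℝ} {r : ℝ} :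
    z ∈ Metric.closedBall p r ↔ |z.1 - p.1| ≤ r ∧ |z.2 - p.2| ≤ r := mem_cb

lemma mem_ob' {z p : ℝ × ℝ} {r : ℝ} :
    z ∈ Metric.ball p r ↔ |z.1 - p.1| < r ∧ |z.2 - p.2| < r := by
  rw [Metric.mem_ball, Prod.dist_eq, max_lt_iff, Real.dist_eq, Real.dist_eq]

lemma quot_bd {φ : ℝ → ℂ} {K : Set ℝ} (hK : IsCompact K) (hφ : ContinuousOn φ K) {x : ℝ} {φ' : ℂ}
    (hd : HasDerivAt φ φ' x) : ∃ n : ℝ, ∀ s ∈ K, ‖φ s - φ x‖ ≤ n * |s - x| := by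
  obtain ⟨c, hc⟩ := hd.isBigO_sub.bound
  obtain ⟨ε, hε, hb⟩ := Metric.eventually_nhds_iff.1 hc
  obtain ⟨B, hB⟩ := hK.exists_bound_of_continuousOn (hφ.sub (continuousOn_const (c := φ x)))
  refine ⟨|c| + |B| / ε, fun s hs => ?_⟩
  by_cases h : |s - x| < ε
  · refine (hb (y := s) (by rwa [Real.dist_eq])).trans ?_
    rw [Real.norm_eq_abs]
    have : 0 ≤ |B| / ε := by positivity
    have h2 := le_abs_self c
    gcongr
    linarith
  · push Not at h
    refine (hB s hs).trans ((le_abs_self B).trans ?_)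
    have : |B| = |B| / ε * ε := by field_simp
    have h3 : |B| / ε * ε ≤ |B| / ε * |s - x| := by gcongr
    have h4 : 0 ≤ |c| * |s - x| := by positivity
    rw [add_mul]; linarith

lemma baire {g : ℝ → ℝ → ℂ} {D C : Set (ℝ × ℝ)} (hD : IsOpen D) (hC : IsClosed C)
    (hne : (C ∩ D).Nonempty) (hg : ∀ p ∈ D, CRAt g p.1 p.2) :
    ∃ p ∈ C ∩ D, ∃ r > 0, ∃ n : ℝ, 0 ≤ n ∧ Metric.closedBall p r ⊆ D ∧
      ∀ z ∈ C, z ∈ Metric.closedBall p r →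
        (∀ s, |s - p.1| ≤ r → ‖g s z.2 - g z.1 z.2‖ ≤ n * |s - z.1|) ∧
        (∀ t, |t - p.2| ≤ r → ‖g z.1 t - g z.1 z.2‖ ≤ n * |t - z.2|) := by
  obtain ⟨p0, hp0C, hp0D⟩ := hne
  obtain ⟨r0, hr0, hr0D⟩ := Metric.nhds_basis_closedBall.mem_iff.1 (hD.mem_nhds hp0D)
  set T0 : Set (ℝ × ℝ) := C ∩ Metric.ball p0 r0 with hT0
  have hlc : IsLocallyClosed T0 := hC.isLocallyClosed.inter Metric.isOpen_ball.isLocallyClosed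
  have : LocallyCompactSpace T0 := hlc.locallyCompactSpace
  have hneT : Nonempty T0 := ⟨⟨p0, hp0C, Metric.mem_ball_self hr0⟩⟩
  have hcr : ∀ a b, |a - p0.1| ≤ r0 → |b - p0.2| ≤ r0 → CRAt g a b :=
    fun a b ha hb => hg (a, b) (hr0D (mem_cb.2 ⟨ha, hb⟩))
  set E : ℕ → Set T0 := fun n => {z | (∀ s, |s - p0.1| ≤ r0 → ‖g s z.1.2 - g z.1.1 z.1.2‖ ≤ n * |s - z.1.1|) ∧
        (∀ t, |t - p0.2| ≤ r0 → ‖g z.1.1 t - g z.1.1 z.1.2‖ ≤ n * |t - z.1.2|)} with hE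
  have hT0m : ∀ z : T0, |z.1.1 - p0.1| ≤ r0 ∧ |z.1.2 - p0.2| ≤ r0 := by
    intro z
    obtain ⟨h1, h2⟩ := mem_ob'.1 z.2.2
    exact ⟨h1.le, h2.le⟩
  have hEc : ∀ n, IsClosed (E n) := by
    intro n
    rw [← isSeqClosed_iff_isClosed]
    intro zk z hzk hlim
    have l0 : Tendsto (fun k => (zk k).1) atTop (𝓝 z.1) := (continuous_subtype_val.tendsto z).comp hlim
    have l1 : Tendsto (fun k => (zk k).1.1) atTop (𝓝 z.1.1) := (continuous_fst.tendsto _).comp l0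
    have l2 : Tendsto (fun k => (zk k).1.2) atTop (𝓝 z.1.2) := (continuous_snd.tendsto _).comp l0
    have m := hT0m z
    have l3 : Tendsto (fun k => g z.1.1 (zk k).1.2) atTop (𝓝 (g z.1.1 z.1.2)) :=
      (hcr _ _ m.1 m.2).cy.tendsto.comp l2
    have l4 : Tendsto (fun k => g (zk k).1.1 (zk k).1.2 - g z.1.1 (zk k).1.2) atTop (𝓝 0) := by
      rw [tendsto_zero_iff_norm_tendsto_zero]
      refine squeeze_zero (g := fun k => n * |z.1.1 - (zk k).1.1|) (fun _ => norm_nonneg _) (fun k => ?_) ?_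
      · rw [norm_sub_rev]
        exact (hzk k).1 _ m.1
      · have := ((l1.const_sub z.1.1).abs).const_mul (n : ℝ)
        simpa using this
    have l5 : Tendsto (fun k => g (zk k).1.1 (zk k).1.2) atTop (𝓝 (g z.1.1 z.1.2)) := by
      have := l4.add l3
      simpa using this
    constructor
    · intro s hs
      have l6 : Tendsto (fun k => g s (zk k).1.2) atTop (𝓝 (g s z.1.2)) :=
        (hcr _ _ hs m.2).cy.tendsto.comp l2
      exact le_of_tendsto_of_tendsto' (l6.sub l5).norm (((l1.const_sub s).abs).const_mul (n : ℝ))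
        fun k => (hzk k).1 s hs
    · intro t ht
      have l6 : Tendsto (fun k => g (zk k).1.1 t) atTop (𝓝 (g z.1.1 t)) :=
        (hcr _ _ m.1 ht).cx.tendsto.comp l1
      exact le_of_tendsto_of_tendsto' (l6.sub l5).norm (((l2.const_sub t).abs).const_mul (n : ℝ))
        fun k => (hzk k).2 t ht
  have hEU : ⋃ n, E n = univ := by
    rw [eq_univ_iff_forall]
    intro z
    have m := hT0m z
    obtain ⟨gx, gy, d1, d2, _⟩ := hcr _ _ m.1 m.2
    obtain ⟨n1, hn1⟩ := quot_bd (isCompact_closedBall p0.1 r0) (φ := fun s => g s z.1.2) (fun s hs =>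
      (hcr s _ (by rwa [Metric.mem_closedBall, Real.dist_eq] at hs) m.2).cx.continuousWithinAt) d1
    obtain ⟨n2, hn2⟩ := quot_bd (isCompact_closedBall p0.2 r0) (φ := fun s => g z.1.1 s) (fun s hs =>
      (hcr _ s m.1 (by rwa [Metric.mem_closedBall, Real.dist_eq] at hs)).cy.continuousWithinAt) d2
    obtain ⟨N, hN⟩ := exists_nat_ge (max n1 n2)
    rw [max_le_iff] at hN
    rw [mem_iUnion]
    refine ⟨N, fun s hs => ?_, fun t ht => ?_⟩
    · refine (hn1 s (by rwa [Metric.mem_closedBall, Real.dist_eq])).trans ?_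
      gcongr; exact hN.1
    · refine (hn2 t (by rwa [Metric.mem_closedBall, Real.dist_eq])).trans ?_
      gcongr; exact hN.2
  obtain ⟨n, z0, hz0⟩ := nonempty_interior_of_iUnion_of_closed hEc hEU
  obtain ⟨V, hV1, hV2⟩ := mem_nhds_subtype T0 z0 (E n) |>.1 (mem_interior_iff_mem_nhds.1 hz0)
  obtain ⟨r, hr, hrV⟩ := Metric.nhds_basis_closedBall.mem_iff.1
    (inter_mem hV1 (Metric.isOpen_ball.mem_nhds z0.2.2))
  have hsub : Metric.closedBall z0.1 r ⊆ Metric.closedBall p0 r0 := fun w hw =>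
    Metric.ball_subset_closedBall (hrV hw).2
  refine ⟨z0.1, ⟨z0.2.1, hr0D (Metric.ball_subset_closedBall z0.2.2)⟩, r, hr, n, n.cast_nonneg,
    hsub.trans hr0D, fun z hzC hz => ?_⟩
  have hzE : (⟨z, hzC, (hrV hz).2⟩ : T0) ∈ E n := hV2 (hrV hz).1
  have hz' := mem_cb'.1 hz
  refine ⟨fun s hs => hzE.1 s (mem_cb.1 (hsub (mem_cb.2 ⟨hs, hz'.2⟩))).1,
    fun t ht => hzE.2 t (mem_cb.1 (hsub (mem_cb.2 ⟨hz'.1, ht⟩))).2⟩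

end LM


namespace LM
open Set
open scoped NNReal

/-- Clamping to the interval of centre `c` and radius `r`. -/
noncomputable def clampR (c r x : ℝ) : ℝ := max (c - r) (min x (c + r))

lemma clampR_cont (c r : ℝ) : Continuous (clampR c r) := by unfold clampR; fun_prop

lemma clampR_mem {c r : ℝ} (hr : 0 ≤ r) (x : ℝ) : |clampR c r x - c| ≤ r := by
  unfold clampR
  rw [abs_le]
  constructor
  · linarith [le_max_left (c - r) (min x (c + r))]
  · have : max (c - r) (min x (c + r)) ≤ c + r := max_le (by linarith) (min_le_right _ _)
    linarith

lemma clampR_eq {c r x : ℝ} (hx : x ∈ Ioo (c - r) (c + r)) : clampR c r x = x := by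
  unfold clampR
  rw [min_eq_left hx.2.le, max_eq_right hx.1.le]

lemma montel {g : ℝ → ℝ → ℂ} {D : Set (ℝ × ℝ)} (hD : IsOpen D) (hg : ∀ p ∈ D, CRAt g p.1 p.2)
    {M : ℝ} (hb : ∀ p ∈ D, ‖g p.1 p.2‖ ≤ M) : ∀ p ∈ D, AnalyticAt ℂ (toC g) ⟨p.1, p.2⟩ := by
  have hcm : Continuous fun p : ℝ × ℝ => (⟨p.1, p.2⟩ : ℂ) := Complex.equivRealProdCLM.symm.continuous
  set C : Set (ℝ × ℝ) := {p | AnalyticAt ℂ (toC g) ⟨p.1, p.2⟩}ᶜ with hC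
  have hCc : IsClosed C := by
    rw [hC, isClosed_compl_iff]
    exact (isOpen_analyticAt ℂ (toC g)).preimage hcm
  by_contra hcon
  have hne : (C ∩ D).Nonempty := by
    push Not at hcon
    obtain ⟨p, hp, hp'⟩ := hcon
    exact ⟨p, hp', hp⟩
  obtain ⟨p, hp, r, hr, n, hn, hsub, hcross⟩ := baire hD hCc hne hg
  set G : ℝ → ℝ → ℂ := fun x y => g (clampR p.1 r x) (clampR p.2 r y) with hG
  have hcr : ∀ a b, |a - p.1| ≤ r → |b - p.2| ≤ r → CRAt g a b :=
    fun a b ha hb => hg (a, b) (hsub (mem_cb.2 ⟨ha, hb⟩))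
  have hIo : ∀ {c x : ℝ}, x ∈ Ioo (c - r) (c + r) → |x - c| ≤ r := by
    intro c x hx
    rw [abs_le]; constructor <;> linarith [hx.1, hx.2]
  have hGg : ∀ x ∈ Ioo (p.1 - r) (p.1 + r), ∀ y ∈ Ioo (p.2 - r) (p.2 + r), G x y = g x y := by
    intro x hx y hy
    rw [hG]; simp only; rw [clampR_eq hx, clampR_eq hy]
  have hev : ∀ x ∈ Ioo (p.1 - r) (p.1 + r), ∀ y ∈ Ioo (p.2 - r) (p.2 + r),
      toC G =ᶠ[𝓝 ⟨x, y⟩] toC g := by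
    intro x hx y hy
    have h1 : Ioo (p.1 - r) (p.1 + r) ×ℂ Ioo (p.2 - r) (p.2 + r) ∈ 𝓝 (⟨x, y⟩ : ℂ) :=
      (isOpen_Ioo.reProdIm isOpen_Ioo).mem_nhds (Complex.mem_reProdIm.2 ⟨hx, hy⟩)
    filter_upwards [h1] with z hz
    have := Complex.mem_reProdIm.1 hz
    exact hGg _ this.1 _ this.2
  have S : Setup G (C ∩ Metric.closedBall p r) (p.1 - r) (p.1 + r) (p.2 - r) (p.2 + r) n M := by
    refine ⟨⟨fun y => ?_, fun x => ?_, fun x y => ?_⟩, hCc.inter Metric.isClosed_closedBall, hn, ?_, ?_, ?_, ?_⟩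
    · rw [continuous_iff_continuousAt]
      intro x
      exact ContinuousAt.comp (f := clampR p.1 r) (g := fun s => g s (clampR p.2 r y))
        (hcr _ _ (clampR_mem hr.le x) (clampR_mem hr.le y)).cx (clampR_cont _ _).continuousAt
    · rw [continuous_iff_continuousAt]
      intro y
      exact ContinuousAt.comp (f := clampR p.2 r) (g := fun s => g (clampR p.1 r x) s)
        (hcr _ _ (clampR_mem hr.le x) (clampR_mem hr.le y)).cy (clampR_cont _ _).continuousAt
    · exact hb (_, _) (hsub (mem_cb.2 ⟨clampR_mem hr.le x, clampR_mem hr.le y⟩))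
    · intro x hx y hy hxy
      have h1 : AnalyticAt ℂ (toC g) ⟨x, y⟩ := by
        by_contra h
        exact hxy ⟨h, mem_cb.2 ⟨hIo hx, hIo hy⟩⟩
      exact h1.differentiableAt.congr_of_eventuallyEq (hev x hx y hy)
    · intro x hx y hy
      obtain ⟨gx, gy, d1, d2, e⟩ := hcr x y (hIo hx) (hIo hy)
      refine ⟨gx, gy, d1.congr_of_eventuallyEq ?_, d2.congr_of_eventuallyEq ?_, e⟩
      · filter_upwards [isOpen_Ioo.mem_nhds hx] with s hs using hGg s hs y hy
      · filter_upwards [isOpen_Ioo.mem_nhds hy] with t ht using hGg x hx t ht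
    · intro z hz hz1 hz2 s hs
      rw [hGg s hs _ hz2, hGg _ hz1 _ hz2]
      exact (hcross z hz.1 hz.2).1 s (hIo hs)
    · intro z hz hz1 hz2 t ht
      rw [hGg _ hz1 _ ht, hGg _ hz1 _ hz2]
      exact (hcross z hz.1 hz.2).2 t (hIo ht)
  apply hp.1
  have hpx : p.1 ∈ Ioo (p.1 - r) (p.1 + r) := ⟨by linarith, by linarith⟩
  have hpy : p.2 ∈ Ioo (p.2 - r) (p.2 + r) := ⟨by linarith, by linarith⟩
  have hO : Ioo (p.1 - r) (p.1 + r) ×ℂ Ioo (p.2 - r) (p.2 + r) ∈ 𝓝 (⟨p.1, p.2⟩ : ℂ) :=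
      (isOpen_Ioo.reProdIm isOpen_Ioo).mem_nhds (Complex.mem_reProdIm.2 ⟨hpx, hpy⟩)
  have hdiff : DifferentiableOn ℂ (toC g) (Ioo (p.1 - r) (p.1 + r) ×ℂ Ioo (p.2 - r) (p.2 + r)) := by
    intro z hz
    have hz' := Complex.mem_reProdIm.1 hz
    exact ((S.diff hz'.1 hz'.2).congr_of_eventuallyEq (hev _ hz'.1 _ hz'.2).symm).differentiableWithinAt
  exact hdiff.analyticAt hO

end LM


namespace LM
open Set
open scoped NNReal

lemma no_frontier {g : ℝ → ℝ → ℂ} {D : Set (ℝ × ℝ)} (hD : IsOpen D) (hg : ∀ p ∈ D, CRAt g p.1 p.2)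
    {M : ℝ} (hb : ∀ p ∈ D, ‖g p.1 p.2‖ ≤ M) {z : ℝ × ℝ} (hz : z ∈ D)
    (hcl : z ∈ closure (interior {p : ℝ × ℝ | g p.1 p.2 = 0})) :
    z ∈ interior {p : ℝ × ℝ | g p.1 p.2 = 0} := by
  by_contra hcon
  have hcm : Continuous fun p : ℝ × ℝ => (⟨p.1, p.2⟩ : ℂ) := Complex.equivRealProdCLM.symm.continuous
  have han := montel hD hg hb z hz
  have hfr : ∃ᶠ q : ℝ × ℝ in 𝓝 z, (⟨q.1, q.2⟩ : ℂ) ∈ ({⟨z.1, z.2⟩}ᶜ : Set ℂ) ∧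
      toC g ⟨q.1, q.2⟩ = 0 := by
    refine (mem_closure_iff_frequently.1 hcl).mono fun q hq => ⟨?_, ?_⟩
    · intro h
      have h' : (⟨q.1, q.2⟩ : ℂ) = ⟨z.1, z.2⟩ := h
      rw [Complex.mk.injEq] at h'
      exact hcon (Prod.ext h'.1 h'.2 ▸ hq)
    · exact (interior_subset hq : q ∈ {p : ℝ × ℝ | g p.1 p.2 = 0})
  have hfr2 := (hcm.tendsto z).frequently (p := fun w => w ∈ ({⟨z.1, z.2⟩}ᶜ : Set ℂ) ∧ toC g w = 0) hfr
  have hfr3 : ∃ᶠ w in 𝓝[≠] (⟨z.1, z.2⟩ : ℂ), toC g w = 0 := by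
    rw [frequently_nhdsWithin_iff]
    exact hfr2.mono fun w hw => ⟨hw.2, hw.1⟩
  have hev := han.frequently_zero_iff_eventually_zero.1 hfr3
  exact hcon (mem_interior_iff_mem_nhds.2 ((hcm.tendsto z).eventually hev))

lemma uniqueness {g : ℝ → ℝ → ℂ} {D : Set (ℝ × ℝ)} (hD : IsOpen D) (hpc : IsPreconnected D)
    (hg : ∀ p ∈ D, CRAt g p.1 p.2)
    (hne : (D ∩ interior {p : ℝ × ℝ | g p.1 p.2 = 0}).Nonempty) :
    ∀ p ∈ D, g p.1 p.2 = 0 := by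
  set Z : Set (ℝ × ℝ) := interior {p : ℝ × ℝ | g p.1 p.2 = 0} with hZ
  have hZo : IsOpen Z := isOpen_interior
  suffices D ⊆ Z from fun p hp => (interior_subset (this hp) : p ∈ {p : ℝ × ℝ | g p.1 p.2 = 0})
  apply hpc.subset_of_closure_inter_subset hZo hne
  by_contra hcon
  have hneC : (frontier Z ∩ D).Nonempty := by
    rw [not_subset] at hcon
    obtain ⟨p, ⟨hp1, hp2⟩, hp3⟩ := hcon
    exact ⟨p, by rw [hZo.frontier_eq]; exact ⟨hp1, hp3⟩, hp2⟩
  obtain ⟨p, ⟨hpC, hpD⟩, r, hr, n, hn, hsub, hcross⟩ := baire hD isClosed_frontier hneC hg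
  have hZf : ∀ z ∈ frontier Z, z ∈ closure Z ∧ z ∉ Z := by
    intro z hz; rw [hZo.frontier_eq] at hz; exact hz
  have hcr : ∀ a b, |a - p.1| ≤ r → |b - p.2| ≤ r → CRAt g a b :=
    fun a b ha hb => hg (a, b) (hsub (mem_cb.2 ⟨ha, hb⟩))
  have hdd : ∀ {a b c : ℝ}, |a - c| ≤ r → |b - c| ≤ r → |a - b| ≤ 2 * r := by
    intro a b c ha hb
    rw [abs_le] at *
    constructor <;> linarith [ha.1, ha.2, hb.1, hb.2]
  have hT : ∀ z ∈ frontier Z, |z.1 - p.1| ≤ r → |z.2 - p.2| ≤ r →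
      ‖g z.1 z.2‖ ≤ ‖g p.1 p.2‖ + 4 * (n * r) := by
    intro z hz h1 h2
    have a1 := (hcross z hz (mem_cb'.2 ⟨h1, h2⟩)).1 p.1 (by simpa using hr.le)
    have a2 := (hcross p hpC (Metric.mem_closedBall_self hr.le)).2 z.2 h2
    have b1 : n * |p.1 - z.1| ≤ n * r := by rw [abs_sub_comm]; gcongr
    have b2 : n * |z.2 - p.2| ≤ n * r := by gcongr
    have c1 := norm_sub_norm_le (g z.1 z.2) (g p.1 z.2)
    have c2 := norm_sub_norm_le (g p.1 z.2) (g p.1 p.2)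
    rw [norm_sub_rev] at c1
    have : 0 ≤ n * r := by positivity
    linarith
  set M := ‖g p.1 p.2‖ + 6 * (n * r) with hM
  have hTx : ∀ z ∈ frontier Z, |z.1 - p.1| ≤ r → |z.2 - p.2| ≤ r → ∀ y, |y - p.2| ≤ r → ‖g z.1 y‖ ≤ M := by
    intro z hz h1 h2 y hy
    have a1 := (hcross z hz (mem_cb'.2 ⟨h1, h2⟩)).2 y hy
    have b1 : n * |y - z.2| ≤ n * (2 * r) := by gcongr; exact hdd hy h2
    have c1 := norm_sub_norm_le (g z.1 y) (g z.1 z.2)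
    linarith [hT z hz h1 h2]
  have hTy : ∀ z ∈ frontier Z, |z.1 - p.1| ≤ r → |z.2 - p.2| ≤ r → ∀ x, |x - p.1| ≤ r → ‖g x z.2‖ ≤ M := by
    intro z hz h1 h2 x hx
    have a1 := (hcross z hz (mem_cb'.2 ⟨h1, h2⟩)).1 x hx
    have b1 : n * |x - z.1| ≤ n * (2 * r) := by gcongr; exact hdd hx h1
    have c1 := norm_sub_norm_le (g x z.2) (g z.1 z.2)
    linarith [hT z hz h1 h2]
  have hIo : ∀ {c x : ℝ}, x ∈ Ioo (c - r) (c + r) → |x - c| ≤ r := by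
    intro c x hx
    rw [abs_le]; constructor <;> linarith [hx.1, hx.2]
  -- the projections are nowhere dense
  have hGx : ∀ α β, α < β → Ioo α β ⊆ Ioo (p.1 - r) (p.1 + r) → ∃ x ∈ Ioo α β,
      ∀ y ∈ Ioo (p.2 - r) (p.2 + r), (x, y) ∉ frontier Z := by
    intro α β hαβ hsubI
    by_contra hno
    push Not at hno
    have hbd : ∀ q ∈ Ioo α β ×ˢ Ioo (p.2 - r) (p.2 + r), ‖g q.1 q.2‖ ≤ M := by
      rintro ⟨x, y⟩ ⟨hx, hy⟩
      obtain ⟨y', hy', hf⟩ := hno x hx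
      exact hTx (x, y') hf (hIo (hsubI hx)) (hIo hy') y (hIo hy)
    obtain ⟨x, hx⟩ := exists_between hαβ
    obtain ⟨y, hy, hf⟩ := hno x hx
    refine (hZf _ hf).2 (no_frontier (isOpen_Ioo.prod isOpen_Ioo) (fun q hq =>
      hcr _ _ (hIo (hsubI hq.1)) (hIo hq.2)) hbd ⟨hx, hy⟩ (hZf _ hf).1)
  have hGy : ∀ α β, α < β → Ioo α β ⊆ Ioo (p.2 - r) (p.2 + r) → ∃ y ∈ Ioo α β,
      ∀ x ∈ Ioo (p.1 - r) (p.1 + r), (x, y) ∉ frontier Z := by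
    intro α β hαβ hsubI
    by_contra hno
    push Not at hno
    have hbd : ∀ q ∈ Ioo (p.1 - r) (p.1 + r) ×ˢ Ioo α β, ‖g q.1 q.2‖ ≤ M := by
      rintro ⟨x, y⟩ ⟨hx, hy⟩
      obtain ⟨x', hx', hf⟩ := hno y hy
      exact hTy (x', y) hf (hIo hx') (hIo (hsubI hy)) x (hIo hx)
    obtain ⟨y, hy⟩ := exists_between hαβ
    obtain ⟨x, hx, hf⟩ := hno y hy
    refine (hZf _ hf).2 (no_frontier (isOpen_Ioo.prod isOpen_Ioo) (fun q hq =>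
      hcr _ _ (hIo hq.1) (hIo (hsubI hq.2))) hbd ⟨hx, hy⟩ (hZf _ hf).1)
  set B : Set (ℝ × ℝ) := Ioo (p.1 - r) (p.1 + r) ×ˢ Ioo (p.2 - r) (p.2 + r) with hB
  have hBo : IsOpen B := isOpen_Ioo.prod isOpen_Ioo
  have hpB : p ∈ B := ⟨⟨by linarith, by linarith⟩, by linarith, by linarith⟩
  obtain ⟨u, huB, huZ⟩ := mem_closure_iff.1 (hZf p hpC).1 B hBo hpB
  obtain ⟨ε, hε, hεs⟩ := Metric.isOpen_iff.1 (hBo.inter hZo) u ⟨huB, huZ⟩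
  obtain ⟨x0, hx0, hx0f⟩ := hGx (u.1 - ε) (u.1 + ε) (by linarith) (by
    intro x hx
    have : ((x, u.2) : ℝ × ℝ) ∈ Metric.ball u ε := by
      rw [mem_ob', abs_lt, sub_self, abs_zero]
      exact ⟨⟨by linarith [hx.1], by linarith [hx.2]⟩, hε⟩
    exact (hεs this).1.1)
  have hx0Z : ((x0, u.2) : ℝ × ℝ) ∈ B ∩ Z := by
    apply hεs
    rw [mem_ob', abs_lt, sub_self, abs_zero]
    exact ⟨⟨by linarith [hx0.1], by linarith [hx0.2]⟩, hε⟩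
  have hcol : ({x0} : Set ℝ) ×ˢ Ioo (p.2 - r) (p.2 + r) ⊆ Z := by
    apply (isPreconnected_singleton.prod isPreconnected_Ioo).subset_of_closure_inter_subset hZo
    · exact ⟨(x0, u.2), ⟨rfl, huB.2⟩, hx0Z.2⟩
    · rintro ⟨x, y⟩ ⟨h1, h2, h3⟩
      by_contra h4
      obtain rfl : x = x0 := h2
      exact hx0f y h3 (by rw [hZo.frontier_eq]; exact ⟨h1, h4⟩)
  have hrow : ∀ y ∈ Ioo (p.2 - r) (p.2 + r), (∀ x ∈ Ioo (p.1 - r) (p.1 + r), (x, y) ∉ frontier Z) →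
      Ioo (p.1 - r) (p.1 + r) ×ˢ ({y} : Set ℝ) ⊆ Z := by
    intro y hy hyf
    apply (isPreconnected_Ioo.prod isPreconnected_singleton).subset_of_closure_inter_subset hZo
    · exact ⟨(x0, y), ⟨hx0Z.1.1, rfl⟩, hcol ⟨rfl, hy⟩⟩
    · rintro ⟨x, y'⟩ ⟨h1, h2, h3⟩
      by_contra h4
      obtain rfl : y' = y := h3
      exact hyf x h2 (by rw [hZo.frontier_eq]; exact ⟨h1, h4⟩)
  have hzero : B ⊆ {q : ℝ × ℝ | g q.1 q.2 = 0} := by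
    rintro ⟨x, y⟩ ⟨hx, hy⟩
    have hc := (hcr x y (hIo hx) (hIo hy)).cy
    have hfr : ∃ᶠ t in 𝓝 y, g x t ∈ ({0} : Set ℂ) := by
      rw [Filter.frequently_iff]
      intro U hU
      obtain ⟨α, β, hyab, hab⟩ := mem_nhds_iff_exists_Ioo_subset.1 (inter_mem hU (isOpen_Ioo.mem_nhds hy))
      obtain ⟨t, ht, htf⟩ := hGy α β (hyab.1.trans hyab.2) (fun s hs => (hab hs).2)
      have := hrow t (hab ht).2 htf (show ((x, t) : ℝ × ℝ) ∈ _ from ⟨hx, rfl⟩)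
      exact ⟨t, (hab ht).1, (interior_subset this : ((x, t) : ℝ × ℝ) ∈ {p : ℝ × ℝ | g p.1 p.2 = 0})⟩
    have := isClosed_singleton.mem_of_frequently_of_tendsto hfr hc
    exact this
  exact (hZf p hpC).2 (interior_maximal hzero hBo hpB)

end LM


namespace LM
open Set
open scoped NNReal

lemma disc_open : IsOpen {p : ℝ × ℝ | p.1 ^ 2 + p.2 ^ 2 < 1} :=
  isOpen_lt (by fun_prop) continuous_const

lemma disc_pc : IsPreconnected {p : ℝ × ℝ | p.1 ^ 2 + p.2 ^ 2 < 1} := by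
  have : {p : ℝ × ℝ | p.1 ^ 2 + p.2 ^ 2 < 1} = Complex.equivRealProdCLM '' Metric.ball 0 1 := by
    ext p
    constructor
    · intro hp
      refine ⟨⟨p.1, p.2⟩, ?_, rfl⟩
      rw [mem_ball_zero_iff, ← sq_lt_one_iff₀ (norm_nonneg _), Complex.sq_norm, Complex.normSq_mk]
      have hp' : p.1 ^ 2 + p.2 ^ 2 < 1 := hp
      linarith
    · rintro ⟨z, hz, rfl⟩
      rw [mem_ball_zero_iff, ← sq_lt_one_iff₀ (norm_nonneg _), Complex.sq_norm, Complex.normSq_apply] at hz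
      change z.re ^ 2 + z.im ^ 2 < 1
      linarith
  rw [this]
  exact (convex_ball (0:ℂ) 1).isPreconnected.image _ Complex.equivRealProdCLM.continuous.continuousOn

lemma upper {h : ℝ → ℝ → ℂ} (hcr : ∀ x y, x ^ 2 + y ^ 2 < 1 → CRAt h x y)
    (h0 : ∀ x : ℝ, x ^ 2 < 1 → h x 0 = 0) : ∀ x y, x ^ 2 + y ^ 2 < 1 → 0 ≤ y → h x y = 0 := by
  set g : ℝ → ℝ → ℂ := fun x y => if 0 ≤ y then h x y else 0 with hg
  have gpos : ∀ x y, 0 ≤ y → g x y = h x y := fun x y hy => if_pos hy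
  have gneg : ∀ x y, y < 0 → g x y = 0 := fun x y hy => if_neg (not_le.2 hy)
  have hCR : ∀ p ∈ {p : ℝ × ℝ | p.1 ^ 2 + p.2 ^ 2 < 1}, CRAt g p.1 p.2 := by
    rintro ⟨x, y⟩ hp
    have hp' : x ^ 2 + y ^ 2 < 1 := hp
    simp only
    rcases lt_trichotomy y 0 with hy | hy | hy
    · refine ⟨0, 0, ?_, ?_, by simp⟩
      · refine (hasDerivAt_const x (0:ℂ)).congr_of_eventuallyEq (Eventually.of_forall fun s => ?_)
        exact gneg s y hy
      · refine (hasDerivAt_const y (0:ℂ)).congr_of_eventuallyEq ?_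
        filter_upwards [isOpen_Iio.mem_nhds hy] with t ht using gneg x t ht
    · subst hy
      obtain ⟨hx, hy, d1, d2, e⟩ := hcr x 0 hp'
      have hx2 : x ^ 2 < 1 := by simpa using hp'
      have hnear : ∀ᶠ s in 𝓝 x, h s 0 = 0 := by
        have : {s : ℝ | s ^ 2 < 1} ∈ 𝓝 x := (isOpen_lt (by fun_prop) continuous_const).mem_nhds hx2
        filter_upwards [this] with s hs using h0 s hs
      have d0 : HasDerivAt (fun s => h s 0) 0 x := (hasDerivAt_const x (0:ℂ)).congr_of_eventuallyEq hnear
      have hx0 : hx = 0 := d1.unique d0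
      have hy0 : hy = 0 := by
        rw [hx0, zero_add] at e
        exact (mul_eq_zero.1 e).resolve_left Complex.I_ne_zero
      rw [hy0] at d2
      refine ⟨0, 0, d0.congr_of_eventuallyEq (Eventually.of_forall fun s => gpos s 0 le_rfl), ?_, by simp⟩
      have w1 : HasDerivWithinAt (fun t => g x t) 0 (Ici 0) 0 :=
        d2.hasDerivWithinAt.congr (fun t ht => gpos x t ht) (gpos x 0 le_rfl)
      have w2 : HasDerivWithinAt (fun t => g x t) 0 (Iio 0) 0 :=
        (hasDerivAt_const (0:ℝ) (0:ℂ)).hasDerivWithinAt.congr (fun t ht => gneg x t ht)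
          ((gpos x 0 le_rfl).trans (h0 x hx2))
      have w3 := w1.union w2
      rwa [Ici_union_Iio, hasDerivWithinAt_univ] at w3
    · obtain ⟨hx, hy', d1, d2, e⟩ := hcr x y hp'
      refine ⟨hx, hy', d1.congr_of_eventuallyEq (Eventually.of_forall fun s => gpos s y hy.le),
        d2.congr_of_eventuallyEq ?_, e⟩
      filter_upwards [isOpen_Ioi.mem_nhds hy] with t ht using gpos x t (le_of_lt ht)
  have key := uniqueness disc_open disc_pc hCR (by
    refine ⟨(0, -1/2), by norm_num, ?_⟩
    have hs : {p : ℝ × ℝ | p.2 < 0} ⊆ {p : ℝ × ℝ | g p.1 p.2 = 0} := fun p hp => gneg _ _ hp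
    refine interior_maximal hs (isOpen_lt continuous_snd continuous_const) ?_
    norm_num)
  intro x y hxy hy
  rw [← gpos x y hy]
  exact key (x, y) hxy

lemma disc_zero {h : ℝ → ℝ → ℂ} (hcr : ∀ x y, x ^ 2 + y ^ 2 < 1 → CRAt h x y)
    (h0 : ∀ x : ℝ, x ^ 2 < 1 → h x 0 = 0) : ∀ x y, x ^ 2 + y ^ 2 < 1 → h x y = 0 := by
  intro x y hxy
  rcases le_total 0 y with hy | hy
  · exact upper hcr h0 x y hxy hy
  · have := upper (h := fun x y => star (h x (-y))) ?_ ?_ x (-y) (by simpa using hxy) (by linarith)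
    · simpa using this
    · intro x y hxy
      obtain ⟨hx, hy, d1, d2, e⟩ := hcr x (-y) (by simpa using hxy)
      refine ⟨star hx, star (-hy), d1.star, ?_, ?_⟩
      · have := d2.scomp y (hasDerivAt_neg y)
        simp only [neg_smul, one_smul] at this
        exact this.star
      · have e2 := congrArg star e
        rw [star_add, star_mul, star_zero] at e2
        have : star Complex.I = -Complex.I := Complex.conj_I
        rw [this] at e2
        rw [star_neg]
        linear_combination e2
    · intro x hx
      simp [h0 x hx]

end LM

namespace LM
open Set
open scoped NNReal

lemma us_re {I : Quaternion ℝ} (hI : I ∈ USphere) : I.re = 0 := by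
  have h : I ^ 2 = -1 := hI
  rw [sq] at h
  have h0 := congrArg (fun q : Quaternion ℝ => q.re) h
  have h1 := congrArg (fun q : Quaternion ℝ => q.imI) h
  have h2 := congrArg (fun q : Quaternion ℝ => q.imJ) h
  have h3 := congrArg (fun q : Quaternion ℝ => q.imK) h
  have ore : QuaternionAlgebra.re (1 : Quaternion ℝ) = 1 := rfl
  have oimI : QuaternionAlgebra.imI (1 : Quaternion ℝ) = 0 := rfl
  have oimJ : QuaternionAlgebra.imJ (1 : Quaternion ℝ) = 0 := rfl
  have oimK : QuaternionAlgebra.imK (1 : Quaternion ℝ) = 0 := rfl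
  simp [ore, oimI, oimJ, oimK] at h0 h1 h2 h3
  by_contra hne
  have e1 : I.imI = 0 := by
    have : I.re * I.imI = 0 := by linarith
    exact (mul_eq_zero.1 this).resolve_left hne
  have e2 : I.imJ = 0 := by
    have : I.re * I.imJ = 0 := by linarith
    exact (mul_eq_zero.1 this).resolve_left hne
  have e3 : I.imK = 0 := by
    have : I.re * I.imK = 0 := by linarith
    exact (mul_eq_zero.1 this).resolve_left hne
  rw [e1, e2, e3] at h0
  nlinarith [sq_nonneg I.re]

lemma us_mul {I : Quaternion ℝ} (hI : I ∈ USphere) : I * I = -1 := by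
  have h : I ^ 2 = -1 := hI
  rwa [sq] at h

lemma us_ball {I : Quaternion ℝ} (hI : I ∈ USphere) (x y : ℝ) :
    ((x : Quaternion ℝ) + y • I) ∈ QBall ↔ x ^ 2 + y ^ 2 < 1 := by
  have hre := us_re hI
  have h0 := congrArg (fun q : Quaternion ℝ => q.re) (us_mul hI)
  have ore : QuaternionAlgebra.re (1 : Quaternion ℝ) = 1 := rfl
  simp [ore] at h0
  have : ‖(x : Quaternion ℝ) + y • I‖ ^ 2 = x ^ 2 + y ^ 2 := by
    rw [sq, ← Quaternion.normSq_eq_norm_mul_self, Quaternion.normSq_def']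
    simp [hre] at h0 ⊢
    linear_combination (-y ^ 2) * h0
  rw [← this]
  change ‖(x : Quaternion ℝ) + y • I‖ < 1 ↔ _
  rw [sq_lt_one_iff₀ (norm_nonneg _)]

lemma us_neg {I : Quaternion ℝ} (hI : I ∈ USphere) : -I ∈ USphere := by
  change (-I) ^ 2 = -1
  rw [neg_sq]; exact hI

/-- The real-linear functional intertwining left multiplication by `J` with multiplication by `i`. -/
noncomputable def ell (J c : Quaternion ℝ) : Quaternion ℝ →ₗ[ℝ] ℂ where
  toFun q := ⟨(q * c).re, -(J * q * c).re⟩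
  map_add' p q := by
    apply Complex.ext
    · simp only [add_mul, Complex.add_re, Quaternion.re_add]
    · simp only [mul_add, add_mul, Complex.add_im, Quaternion.re_add]; ring
  map_smul' r q := by
    apply Complex.ext
    · simp only [smul_mul_assoc, Quaternion.re_smul, RingHom.id_apply, Complex.smul_re]
    · simp only [mul_smul_comm, smul_mul_assoc, Quaternion.re_smul, RingHom.id_apply,
        Complex.smul_im, smul_eq_mul]; ring

lemma ell_J {J : Quaternion ℝ} (hJ : J ∈ USphere) (c q : Quaternion ℝ) :
    ell J c (J * q) = Complex.I * ell J c q := by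
  apply Complex.ext
  · simp [ell]
  · have : J * (J * q) * c = -(q * c) := by
      rw [← mul_assoc J J q, us_mul hJ]; simp
    simp only [ell, LinearMap.coe_mk, AddHom.coe_mk, this]
    simp

lemma ell_zero {J q : Quaternion ℝ} (h : ∀ c, ell J c q = 0) : q = 0 := by
  have := congrArg Complex.re (h (star q))
  have h2 : (q * star q).re = 0 := this
  rw [Quaternion.self_mul_star] at h2
  exact Quaternion.normSq_eq_zero.1 (by simpa using h2)

lemma HasDerivAt_ell (J c : Quaternion ℝ) {φ : ℝ → Quaternion ℝ} {φ' : Quaternion ℝ} {x : ℝ}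
    (h : HasDerivAt φ φ' x) : HasDerivAt (fun t => ell J c (φ t)) (ell J c φ') x :=
  ((ell J c).toContinuousLinearMap.hasFDerivAt (x := φ x)).comp_hasDerivAt x h

lemma quat_zero {J : Quaternion ℝ} (hJ : J ∈ USphere) (H : ℝ → ℝ → Quaternion ℝ)
    (hcr : ∀ x y, x ^ 2 + y ^ 2 < 1 → ∃ hx hy, HasDerivAt (fun s => H s y) hx x ∧
      HasDerivAt (fun t => H x t) hy y ∧ hx + J * hy = 0)
    (h0 : ∀ x : ℝ, x ^ 2 < 1 → H x 0 = 0) : ∀ x y, x ^ 2 + y ^ 2 < 1 → H x y = 0 := by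
  intro x y hxy
  apply ell_zero (J := J)
  intro c
  refine disc_zero (h := fun x y => ell J c (H x y)) ?_ ?_ x y hxy
  · intro x y hxy
    obtain ⟨hx, hy, d1, d2, e⟩ := hcr x y hxy
    refine ⟨_, _, HasDerivAt_ell J c d1, HasDerivAt_ell J c d2, ?_⟩
    rw [← ell_J hJ, ← map_add, e, map_zero]
  · intro x hx
    simp only [h0 x hx, map_zero]

lemma rep_formula {f : Quaternion ℝ → Quaternion ℝ} (hf : SliceRegular f)
    {I : Quaternion ℝ} (hI : I ∈ USphere) {J : Quaternion ℝ} (hJ : J ∈ USphere) (x y : ℝ)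
    (hxy : x ^ 2 + y ^ 2 < 1) :
    f ((x : Quaternion ℝ) + y • J) = (1/2 : ℝ) • ((f ((x : Quaternion ℝ) + y • I) + f ((x : Quaternion ℝ) + y • (-I)))
      - J * (I * (f ((x : Quaternion ℝ) + y • I) - f ((x : Quaternion ℝ) + y • (-I))))) := by
  rw [← sub_eq_zero]
  refine quat_zero hJ (fun x y : ℝ => f ((x : Quaternion ℝ) + y • J) - (1/2 : ℝ) • ((f ((x : Quaternion ℝ) + y • I) + f ((x : Quaternion ℝ) + y • (-I)))
      - J * (I * (f ((x : Quaternion ℝ) + y • I) - f ((x : Quaternion ℝ) + y • (-I)))))) ?_ ?_ x y hxy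
  · intro x y hxy
    obtain ⟨a, b, a1, b1, e1⟩ := hf J hJ x y ((us_ball hJ x y).2 hxy)
    obtain ⟨p, q, p1, q1, e2⟩ := hf I hI x y ((us_ball hI x y).2 hxy)
    obtain ⟨u, v, u1, v1, e3⟩ := hf (-I) (us_neg hI) x y ((us_ball (us_neg hI) x y).2 hxy)
    refine ⟨_, _, a1.sub (((p1.add u1).sub (((p1.sub u1).const_mul I).const_mul J)).const_smul (1/2 : ℝ)),
      b1.sub (((q1.add v1).sub (((q1.sub v1).const_mul I).const_mul J)).const_smul (1/2 : ℝ)), ?_⟩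
    have ea : a = -(J * b) := eq_neg_of_add_eq_zero_left e1
    have ep : p = -(I * q) := eq_neg_of_add_eq_zero_left e2
    have eu : u = I * v := by
      have := eq_neg_of_add_eq_zero_left e3
      rw [this]; simp
    subst ea ep eu
    have hII : ∀ w, I * (I * w) = -w := fun w => by rw [← mul_assoc, us_mul hI]; simp
    have hJJ : ∀ w, J * (J * w) = -w := fun w => by rw [← mul_assoc, us_mul hJ]; simp
    simp only [mul_sub, mul_add, mul_neg, mul_smul_comm, hII, hJJ, smul_sub, smul_add, smul_neg]
    abel
  · intro x hx
    simp only [zero_smul, add_zero, sub_self, mul_zero, sub_zero, ← two_smul ℝ (f (x : Quaternion ℝ)), smul_smul]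
    norm_num

end LM

/-- If `f` is slice regular on `𝔹` and preserves the slice `L_I` (i.e. `f(𝔹_I) ⊆ L_I`)
for some `I ∈ 𝕊`, and `f(x + yJ) = 0` for some `J ∈ 𝕊 \ {±I}`, then `f(x + yK) = 0`
for every `K ∈ 𝕊`. -/
theorem zeros_of_slice_preserving (f : Quaternion ℝ → Quaternion ℝ) (hf : SliceRegular f)
    (I : Quaternion ℝ) (hI : I ∈ USphere)
    (hpres : ∀ q ∈ QBall ∩ sliceSet I, f q ∈ sliceSet I)
    (x y : ℝ) (J : Quaternion ℝ) (hJ : J ∈ USphere) (hJI : J ≠ I) (hJI' : J ≠ -I)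
    (hmem : ((x : Quaternion ℝ) + y • J) ∈ QBall)
    (hzero : f ((x : Quaternion ℝ) + y • J) = 0) :
    ∀ K ∈ USphere, f ((x : Quaternion ℝ) + y • K) = 0 := by
  have hxy := (LM.us_ball hJ x y).1 hmem
  have hII := LM.us_mul hI
  obtain ⟨a, b, hab⟩ := hpres _ ⟨(LM.us_ball hI x y).2 hxy, x, y, rfl⟩
  obtain ⟨c, d, hcd⟩ := hpres ((x : Quaternion ℝ) + y • (-I))
    ⟨(LM.us_ball (LM.us_neg hI) x y).2 hxy, x, -y, by simp⟩
  have hrep := LM.rep_formula hf hI hJ x y hxy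
  rw [hzero, hab, hcd] at hrep
  have hS : ((a : Quaternion ℝ) + b • I + ((c : Quaternion ℝ) + d • I)) =
      ((a + c : ℝ) : Quaternion ℝ) + (b + d) • I := by
    rw [add_smul, Quaternion.coe_add]; abel
  have hV : I * ((a : Quaternion ℝ) + b • I - ((c : Quaternion ℝ) + d • I)) =
      ((d - b : ℝ) : Quaternion ℝ) + (a - c) • I := by
    have e1 : ∀ t : ℝ, I * (t : Quaternion ℝ) = t • I := fun t => by
      rw [← Quaternion.coe_commutes, Quaternion.coe_mul_eq_smul]
    rw [mul_sub, mul_add, mul_add, e1, e1, mul_smul_comm, mul_smul_comm, hII, sub_smul,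
      Quaternion.coe_sub]
    have e2 : ∀ t : ℝ, t • (-1 : Quaternion ℝ) = -(t : Quaternion ℝ) := fun t => by
      rw [smul_neg, ← Quaternion.coe_mul_eq_smul, mul_one]
    rw [e2, e2]; abel
  rw [hS, hV] at hrep
  have hrep2 : ((a + c : ℝ) : Quaternion ℝ) + (b + d) • I =
      J * (((d - b : ℝ) : Quaternion ℝ) + (a - c) • I) := by
    have h2 := (smul_eq_zero.1 hrep.symm).resolve_left (by norm_num)
    exact sub_eq_zero.1 h2
  by_cases hN : (d - b) ^ 2 + (a - c) ^ 2 = 0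
  · have hv0 : d - b = 0 := by nlinarith [sq_nonneg (d - b), sq_nonneg (a - c)]
    have hv1 : a - c = 0 := by nlinarith [sq_nonneg (d - b), sq_nonneg (a - c)]
    have hS0 : ((a + c : ℝ) : Quaternion ℝ) + (b + d) • I = 0 := by
      rw [hrep2, hv0, hv1]; simp
    intro K hK
    rw [LM.rep_formula hf hI hK x y hxy, hab, hcd, hS, hV, hS0, hv0, hv1]
    simp
  · exfalso
    set N := (d - b) ^ 2 + (a - c) ^ 2 with hNdef
    have hreI := LM.us_re hI
    have hreJ := LM.us_re hJ
    have hprod : (((d - b : ℝ) : Quaternion ℝ) + (a - c) • I) * (((d - b : ℝ) : Quaternion ℝ) - (a - c) • I)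
        = ((N : ℝ) : Quaternion ℝ) := by
      have : ∀ s t : ℝ, ((s : Quaternion ℝ) + t • I) * ((s : Quaternion ℝ) - t • I) =
          ((s ^ 2 + t ^ 2 : ℝ) : Quaternion ℝ) := by
        intro s t
        have e1 : ∀ t : ℝ, I * (t : Quaternion ℝ) = t • I := fun t => by
          rw [← Quaternion.coe_commutes, Quaternion.coe_mul_eq_smul]
        rw [add_mul, mul_sub, mul_sub, smul_mul_assoc, e1, smul_mul_smul_comm, hII,
          Quaternion.coe_mul_eq_smul, Quaternion.coe_mul_eq_smul, smul_neg,
          ← Quaternion.coe_mul_eq_smul (t * t), mul_one, Quaternion.coe_add, sq, sq,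
          ← Quaternion.coe_mul_eq_smul, ← Quaternion.coe_mul]
        rw [smul_smul, smul_smul, mul_comm t s]
        abel
      exact this _ _
    have hprod2 : ∃ A B : ℝ, (((a + c : ℝ) : Quaternion ℝ) + (b + d) • I) *
        (((d - b : ℝ) : Quaternion ℝ) - (a - c) • I) = (A : Quaternion ℝ) + B • I := by
      have : ∀ p q s t : ℝ, ((p : Quaternion ℝ) + q • I) * ((s : Quaternion ℝ) - t • I) =
          ((p * s + q * t : ℝ) : Quaternion ℝ) + (q * s - p * t) • I := by
        intro p q s t
        have e1 : ∀ t : ℝ, I * (t : Quaternion ℝ) = t • I := fun t => by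
          rw [← Quaternion.coe_commutes, Quaternion.coe_mul_eq_smul]
        rw [add_mul, mul_sub, mul_sub, smul_mul_assoc, e1, smul_mul_smul_comm, hII,
          Quaternion.coe_mul_eq_smul p (t • I), smul_neg,
          ← Quaternion.coe_mul_eq_smul (q * t), mul_one, Quaternion.coe_add,
          Quaternion.coe_mul p s, smul_smul, smul_smul, sub_smul]
        abel
      exact ⟨_, _, this _ _ _ _⟩
    obtain ⟨A, B, hAB⟩ := hprod2
    rw [hrep2, mul_assoc, hprod] at hAB
    have hA : A = 0 := by
      have := congrArg (fun q : Quaternion ℝ => q.re) hAB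
      simp [hreI, hreJ] at this
      linarith
    rw [hA, Quaternion.coe_zero, zero_add, ← Quaternion.coe_commutes, Quaternion.coe_mul_eq_smul] at hAB
    have hJ2 : J = (B / N) • I := by
      rw [div_eq_inv_mul, mul_smul, ← hAB, smul_smul, inv_mul_cancel₀ hN, one_smul]
    have hsq := LM.us_mul hJ
    rw [hJ2, smul_mul_smul_comm, hII] at hsq
    have hk := congrArg (fun q : Quaternion ℝ => q.re) hsq
    have ore : QuaternionAlgebra.re (1 : Quaternion ℝ) = 1 := rfl
    simp [ore] at hk
    have hk2 : (B / N) * (B / N) = 1 := by simpa [ore] using hk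
    rcases mul_self_eq_one_iff.1 hk2 with h | h
    · rw [h, one_smul] at hJ2; exact hJI hJ2
    · rw [h, neg_smul, one_smul] at hJ2; exact hJI' hJ2
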